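/- arXiv:2212.09341 — 2 statements merged into one kernel-verified Lean document; each statement's English description precedes it below -/
import Mathlib

section
/- Let k > n+2 be an integer and c a standard-form cusp. Then for every z ∈ H_S the family g ↦ j(g,z)^{−k}, indexed by the set {g ∈ L₁ + c : Q₁(g) = 0 and gcd(S₁g) = 1}, is absolutely summable, and the function E_{k,S,c}(z) := (1/2)·Σ_{g ∈ L₁+c, Q₁(g)=0, gcd(S₁g)=1} j(g,z)^{−k} is a modular form of weight k for the discriminant kernel: for every M ∈ Γ̃_S and every z ∈ H_S one has M⟨z⟩ ∈ H_S and E_{k,S,c}(M⟨z⟩) = j(M,z)^k · E_{k,S,c}(z). -/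
open Matrix Complex

namespace OEis

/-- Extension of an even Gram matrix by a hyperbolic plane:
`[[0,0,1],[0,A,0],[1,0,0]]`. -/
def hyp {m : ℕ} (A : Matrix (Fin m) (Fin m) ℤ) :
    Matrix (Fin (m + 2)) (Fin (m + 2)) ℤ := fun i j =>
  if hi0 : (i : ℕ) = 0 then (if (j : ℕ) = m + 1 then 1 else 0)
  else if him : (i : ℕ) = m + 1 then (if (j : ℕ) = 0 then 1 else 0)
  else if hj0 : (j : ℕ) = 0 then 0
  else if hjm : (j : ℕ) = m + 1 then 0
  else A ⟨(i : ℕ) - 1, by have := i.isLt; omega⟩ ⟨(j : ℕ) - 1, by have := j.isLt; omega⟩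

variable (n : ℕ) (S : Matrix (Fin n) (Fin n) ℤ)

/-- `S₀ = [[0,0,1],[0,-S,0],[1,0,0]]`. -/
def MatS0 : Matrix (Fin (n + 2)) (Fin (n + 2)) ℤ := hyp (-S)

/-- `S₁ = [[0,0,1],[0,S₀,0],[1,0,0]]`. -/
def MatS1 : Matrix (Fin (n + 4)) (Fin (n + 4)) ℤ := hyp (MatS0 n S)

/-- Bilinear form `uᵀ A v` over a field `K`. -/
def bilin {m : ℕ} (K : Type) [Field K] (A : Matrix (Fin m) (Fin m) ℤ)
    (u v : Fin m → K) : K :=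
  u ⬝ᵥ (A.map (Int.cast : ℤ → K)).mulVec v

/-- Quadratic form `Q_A(v) = vᵀAv/2` over a field `K`. -/
def quadF {m : ℕ} (K : Type) [Field K] (A : Matrix (Fin m) (Fin m) ℤ)
    (v : Fin m → K) : K := bilin K A v v / 2

/-- First component of a vector. -/
def vfirst {m : ℕ} {K : Type} (g : Fin (m + 2) → K) : K := g ⟨0, by omega⟩

/-- Last component of a vector. -/
def vlast {m : ℕ} {K : Type} (g : Fin (m + 2) → K) : K := g ⟨m + 1, by omega⟩

/-- Middle components of a vector. -/
def vmid {m : ℕ} {K : Type} (g : Fin (m + 2) → K) : Fin m → K :=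
  fun i => g ⟨(i : ℕ) + 1, by have := i.isLt; omega⟩

/-- gcd of the entries of a rational vector (via numerators). -/
def ratGcd {m : ℕ} (v : Fin m → ℚ) : ℕ :=
  Finset.gcd Finset.univ fun i => (v i).num.natAbs

/-- `v` has integral entries. -/
def inLat {m : ℕ} (v : Fin m → ℚ) : Prop := ∀ i, ∃ z : ℤ, v i = (z : ℚ)

/-- `g ∈ ℤ^m + c`. -/
def inLatShift {m : ℕ} (c g : Fin m → ℚ) : Prop := ∀ i, ∃ z : ℤ, g i - c i = (z : ℚ)

/-- Membership in the dual lattice `A⁻¹ℤ^m`, i.e. `Av` is integral. -/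
def inDual {m : ℕ} (A : Matrix (Fin m) (Fin m) ℤ) (v : Fin m → ℚ) : Prop :=
  ∀ i, ∃ z : ℤ, ((A.map (Int.cast : ℤ → ℚ)).mulVec v) i = (z : ℚ)

/-- The positive cone `P_S`. -/
def PosCone : Set (Fin (n + 2) → ℝ) :=
  {y | 0 < quadF ℝ (MatS0 n S) y ∧ 0 < y ⟨0, by omega⟩}

/-- The tube domain `H_S`. -/
def HS : Set (Fin (n + 2) → ℂ) :=
  {z | (fun i => (z i).im) ∈ PosCone n S}

/-- Automorphy factor attached to a vector:
`j(g,z) = -γ Q₀(z) + (d,z)₀ + δ` for `g = (δ,dᵀ,γ)ᵀ`. -/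
noncomputable def jay (g : Fin (n + 4) → ℚ) (z : Fin (n + 2) → ℂ) : ℂ :=
  -((vlast g : ℚ) : ℂ) * quadF ℂ (MatS0 n S) z
    + bilin ℂ (MatS0 n S) (fun i => ((vmid g i : ℚ) : ℂ)) z
    + ((vfirst g : ℚ) : ℂ)

/-- The index set of the Eisenstein series attached to a cusp `c`:
`{g ∈ L₁ + c : Q₁(g) = 0, gcd(S₁g) = 1}`. -/
def cuspSet (c : Fin (n + 4) → ℚ) : Set (Fin (n + 4) → ℚ) :=
  {g | inLatShift c g ∧ quadF ℚ (MatS1 n S) g = 0 ∧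
    ratGcd (((MatS1 n S).map (Int.cast : ℤ → ℚ)).mulVec g) = 1}

/-- The standard-form cusp vector `(1, 0, 𝔠ᵀ, 0, Q(𝔠))ᵀ`. -/
def stdCuspVec (fc : Fin n → ℚ) : Fin (n + 4) → ℚ := fun i =>
  if h0 : (i : ℕ) = 0 then 1
  else if h3 : (i : ℕ) = n + 3 then quadF ℚ S fc
  else if h12 : (i : ℕ) = 1 ∨ (i : ℕ) = n + 2 then 0
  else fc ⟨(i : ℕ) - 2, by have := i.isLt; omega⟩

/-- `c` is a standard-form cusp. -/
def IsStdCusp (c : Fin (n + 4) → ℚ) : Prop :=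
  ∃ fc : Fin n → ℚ, inDual S fc ∧ (∃ z : ℤ, quadF ℚ S fc = (z : ℚ)) ∧
    c = stdCuspVec n S fc

/-- The real orthogonal group of `A`. -/
def OSet {m : ℕ} (A : Matrix (Fin m) (Fin m) ℤ) : Set (Matrix (Fin m) (Fin m) ℝ) :=
  {M | Mᵀ * A.map (Int.cast : ℤ → ℝ) * M = A.map (Int.cast : ℤ → ℝ)}

/-- Connected component of the identity in the real orthogonal group. -/
def OPlus {m : ℕ} (A : Matrix (Fin m) (Fin m) ℤ) : Set (Matrix (Fin m) (Fin m) ℝ) :=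
  connectedComponentIn (OSet A) 1

/-- `Γ_S`: integral matrices in `O⁺(S₁;ℝ)`. -/
def GammaS : Set (Matrix (Fin (n + 4)) (Fin (n + 4)) ℝ) :=
  {M | M ∈ OPlus (MatS1 n S) ∧ ∀ i j, ∃ z : ℤ, M i j = (z : ℝ)}

/-- The discriminant kernel `Γ̃_S`. -/
def GammaTilde : Set (Matrix (Fin (n + 4)) (Fin (n + 4)) ℝ) :=
  {M | M ∈ GammaS n S ∧
    ∃ X : Matrix (Fin (n + 4)) (Fin (n + 4)) ℤ,
      M = 1 + (X * MatS1 n S).map (Int.cast : ℤ → ℝ)}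

/-- Automorphy factor of a matrix: `j(M,z) = -γ Q₀(z) + (d,z)₀ + δ`
where `(γ, dᵀS₀, δ)` is the bottom row of `M`. -/
noncomputable def jayM (M : Matrix (Fin (n + 4)) (Fin (n + 4)) ℝ)
    (z : Fin (n + 2) → ℂ) : ℂ :=
  -((M ⟨n + 3, by omega⟩ ⟨0, by omega⟩ : ℝ) : ℂ) * quadF ℂ (MatS0 n S) z
    + ∑ i : Fin (n + 2),
        ((M ⟨n + 3, by omega⟩ ⟨(i : ℕ) + 1, by have := i.isLt; omega⟩ : ℝ) : ℂ) * z i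
    + ((M ⟨n + 3, by omega⟩ ⟨n + 3, by omega⟩ : ℝ) : ℂ)

/-- The action `M⟨z⟩ = (-Q₀(z)·b + Kz + c')·j(M,z)⁻¹`. -/
noncomputable def actM (M : Matrix (Fin (n + 4)) (Fin (n + 4)) ℝ)
    (z : Fin (n + 2) → ℂ) : Fin (n + 2) → ℂ := fun i =>
  (-(quadF ℂ (MatS0 n S) z) *
      ((M ⟨(i : ℕ) + 1, by have := i.isLt; omega⟩ ⟨0, by omega⟩ : ℝ) : ℂ)
    + ∑ j : Fin (n + 2),
        ((M ⟨(i : ℕ) + 1, by have := i.isLt; omega⟩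
            ⟨(j : ℕ) + 1, by have := j.isLt; omega⟩ : ℝ) : ℂ) * z j
    + ((M ⟨(i : ℕ) + 1, by have := i.isLt; omega⟩ ⟨n + 3, by omega⟩ : ℝ) : ℂ))
  * (jayM n S M z)⁻¹

/-- The integral vector `(−Q₀(d)/γ, dᵀ, γ)ᵀ` built from `d` and `γ`. -/
def gExt (d : Fin (n + 2) → ℕ) (γ : ℕ) : Fin (n + 4) → ℚ := fun i =>
  if h0 : (i : ℕ) = 0 then -(quadF ℚ (MatS0 n S) fun j => (d j : ℚ)) / γ
  else if h3 : (i : ℕ) = n + 3 then (γ : ℚ)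
  else (d ⟨(i : ℕ) - 1, by have := i.isLt; omega⟩ : ℚ)

open scoped Classical in
/-- The Dirichlet coefficient `a(λ,γ)`. -/
noncomputable def aCoef (lam : Fin (n + 2) → ℚ) (γ : ℕ) : ℂ :=
  ∑ d ∈ Fintype.piFinset fun _ : Fin (n + 2) => Finset.range γ,
    if (∃ e : ℤ, quadF ℚ (MatS0 n S) (fun j => (d j : ℚ)) = (γ : ℚ) * e) ∧
        ratGcd (((MatS1 n S).map (Int.cast : ℤ → ℚ)).mulVec (gExt n S d γ)) = 1 then
      Complex.exp (2 * Real.pi * Complex.I *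
        ((bilin ℚ (MatS0 n S) lam (fun j => (d j : ℚ)) / γ : ℚ) : ℂ))
    else 0

/-- The convolution `b(λ,γ) = Σ_{δ∣γ} a(λ,δ)`. -/
noncomputable def bCoef (lam : Fin (n + 2) → ℚ) (γ : ℕ) : ℂ :=
  ∑ δ ∈ γ.divisors, aCoef n S lam δ

/-- The order/level of a rational vector: least `N ≥ 1` with `Nv` integral. -/
noncomputable def ordv {m : ℕ} (v : Fin m → ℚ) : ℕ :=
  sInf {N : ℕ | 0 < N ∧ ∀ i, ∃ z : ℤ, (N : ℚ) * v i = (z : ℚ)}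

/-- `S` is `p`-maximal. -/
def pMaximal (p : ℕ) : Prop :=
  ∀ v : Fin n → ℚ, inDual S v → (∃ z : ℤ, quadF ℚ S v = (z : ℚ)) → ¬ p ∣ ordv v

/-- The vector `(l, μᵀ, m)ᵀ ∈ ℚ^{n+2}`. -/
def asmVec (l : ℚ) (μ : Fin n → ℚ) (m : ℚ) : Fin (n + 2) → ℚ := fun i =>
  if h0 : (i : ℕ) = 0 then l
  else if h1 : (i : ℕ) = n + 1 then m
  else μ ⟨(i : ℕ) - 1, by have := i.isLt; omega⟩

open scoped Classical in
/-- The representation number `N(λ, p^ν, p^t)`. -/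
noncomputable def Ncount (lam : Fin (n + 2) → ℚ) (p νl ν t : ℕ) : ℕ :=
  ((Fintype.piFinset fun _ : Fin n => Finset.range (p ^ ν)).filter fun v =>
    (∃ e : ℤ, quadF ℚ S (fun i => (v i : ℚ)) = (p : ℚ) ^ (t : ℕ) * e) ∧
    (∃ e : ℤ, (p : ℚ) ^ ((νl : ℤ) - (t : ℤ)) * quadF ℚ S (fun i => (v i : ℚ))
        - bilin ℚ S (fun i => (v i : ℚ)) (vmid lam)
        + (p : ℚ) ^ ((t : ℤ) - (νl : ℤ)) * lam ⟨0, by omega⟩ * lam ⟨n + 1, by omega⟩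
      = (p : ℚ) ^ (ν : ℕ) * e)).card

/-- `N*(λ,p^ν) = Σ_{t=0}^{min(ν,ν_λ)} N(λ,p^ν,p^t)`. -/
noncomputable def Nstar (lam : Fin (n + 2) → ℚ) (p νl ν : ℕ) : ℕ :=
  ∑ t ∈ Finset.range (min ν νl + 1), Ncount n S lam p νl ν t

/-- Kloosterman sum `K(α,β;γ)` (with `β` allowed rational;
in all uses `β` is an integer). -/
noncomputable def kloos (α : ℤ) (β : ℚ) (γ : ℕ) : ℂ :=
  ∑ j ∈ Finset.range γ,
    if Nat.Coprime j γ then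
      Complex.exp (2 * Real.pi * Complex.I *
        ((((α : ℚ) * j + β * ((((j : ZMod γ)⁻¹).val : ℕ) : ℚ)) / γ : ℚ) : ℂ))
    else 0

/-- `q ≡ 0 (mod p^k)` in `ℤ_p`, for a rational `q`. -/
def pCong (p k : ℕ) (q : ℚ) : Prop :=
  q = 0 ∨ (k : ℤ) ≤ padicValRat p q

/-- The constant `c_{k,S}^• = (2π)^{2k-n/2}/(√(det S)·Γ(k)·Γ(k-n/2))`. -/
noncomputable def ckS (k : ℕ) : ℝ :=
  (2 * Real.pi) ^ ((2 * k : ℝ) - n / 2) /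
    (Real.sqrt ((S.det : ℤ) : ℝ) * Real.Gamma (k : ℝ) * Real.Gamma ((k : ℝ) - n / 2))

end OEis

open OEis

open Matrix Complex

lemma cube_succ_le_eight_mul_two_pow (a : ℕ) : (a + 1) ^ 3 ≤ 8 * 2 ^ a := by
  rcases lt_or_ge a 4 with h | h
  · interval_cases a <;> norm_num
  · induction a, h using Nat.le_induction with
    | base => norm_num
    | succ a ha ih =>
      have h2 : (a + 1 + 1) ^ 3 ≤ 2 * (a + 1) ^ 3 := by nlinarith [Nat.mul_le_mul ha ha]
      rw [pow_succ 2]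
      omega

lemma card_divisors_cube_le {N : ℕ} (hN : N ≠ 0) :
    N.divisors.card ^ 3 ≤ 8 ^ 8 * N := by
  have key : ∀ p ∈ N.primeFactors, (N.factorization p + 1) ^ 3 ≤
      (if p < 8 then 8 else 1) * p ^ N.factorization p := by
    intro p hp
    have hp2 : 2 ≤ p := (Nat.prime_of_mem_primeFactors hp).two_le
    split_ifs with h
    · exact (cube_succ_le_eight_mul_two_pow _).trans
        (Nat.mul_le_mul_left _ (Nat.pow_le_pow_left hp2 _))
    · have h1 : N.factorization p + 1 ≤ 2 ^ N.factorization p := Nat.lt_two_pow_self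
      calc (N.factorization p + 1) ^ 3 ≤ (2 ^ N.factorization p) ^ 3 := Nat.pow_le_pow_left h1 3
        _ = 8 ^ N.factorization p := by rw [← pow_mul, mul_comm, pow_mul]; norm_num
        _ ≤ 1 * p ^ N.factorization p := by
          rw [one_mul]; exact Nat.pow_le_pow_left (not_lt.mp h) _
  rw [Nat.card_divisors hN, ← Finset.prod_pow]
  refine (Finset.prod_le_prod' key).trans ?_
  rw [Finset.prod_mul_distrib]
  refine Nat.mul_le_mul ?_ (Nat.prod_factorization_pow_eq_self hN).le
  rw [← Finset.prod_filter, Finset.prod_const]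
  refine Nat.pow_le_pow_right (by norm_num) ?_
  calc _ ≤ (Finset.range 8).card := Finset.card_le_card fun p hp => by
        simpa using (Finset.mem_filter.mp hp).2
    _ = 8 := by simp

lemma card_le_of_forall_dvd {t : ℤ} (ht : t ≠ 0) (s : Finset ℤ) (hs : ∀ x ∈ s, x ∣ t) :
    ((s.card : ℕ) : ℝ) ^ 3 ≤ 8 ^ 9 * |(t : ℝ)| := by
  have hN : t.natAbs ≠ 0 := Int.natAbs_ne_zero.mpr ht
  have h1 : s.card ≤ 2 * t.natAbs.divisors.card := by
    have : s ⊆ t.natAbs.divisors.image (fun d : ℕ => (d : ℤ)) ∪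
        t.natAbs.divisors.image (fun d : ℕ => -(d : ℤ)) := by
      intro x hx
      have hd : x.natAbs ∈ t.natAbs.divisors :=
        Nat.mem_divisors.mpr ⟨Int.natAbs_dvd_natAbs.mpr (hs x hx), hN⟩
      rcases Int.natAbs_eq x with h | h
      · exact Finset.mem_union_left _ (Finset.mem_image.mpr ⟨_, hd, h.symm⟩)
      · exact Finset.mem_union_right _ (Finset.mem_image.mpr ⟨_, hd, h.symm⟩)
    calc s.card ≤ _ := Finset.card_le_card this
      _ ≤ _ := Finset.card_union_le _ _
      _ ≤ t.natAbs.divisors.card + t.natAbs.divisors.card :=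
        add_le_add Finset.card_image_le Finset.card_image_le
      _ = _ := by ring
  have h2 : s.card ^ 3 ≤ 8 ^ 9 * t.natAbs := by
    calc s.card ^ 3 ≤ (2 * t.natAbs.divisors.card) ^ 3 := Nat.pow_le_pow_left h1 3
      _ = 8 * t.natAbs.divisors.card ^ 3 := by ring
      _ ≤ 8 * (8 ^ 8 * t.natAbs) := Nat.mul_le_mul_left _ (card_divisors_cube_le hN)
      _ = _ := by ring
  have h3 : ((s.card ^ 3 : ℕ) : ℝ) ≤ ((8 ^ 9 * t.natAbs : ℕ) : ℝ) := by exact_mod_cast h2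
  push_cast [Nat.cast_natAbs] at h3
  linarith

lemma summable_one_add_norm_rpow (d : ℕ) (r : ℝ) (hd : 0 < d) (hr : r < -d) :
    Summable fun y : Fin d → ℤ => (1 + ‖y‖) ^ r := by
  let L : Submodule ℤ (Fin d → ℝ) := Submodule.span ℤ (Set.range (Pi.basisFun ℝ (Fin d)))
  have hrank : Module.finrank ℤ L = d := by
    rw [ZLattice.rank ℝ L]; simp
  have hL := ZLattice.summable_norm_rpow L r (by rw [hrank]; exact hr)
  have hmem : ∀ y : Fin d → ℤ, (fun i => (y i : ℝ)) ∈ L := by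
    intro y
    rw [Module.Basis.mem_span_iff_repr_mem]
    intro i
    exact ⟨y i, by simp⟩
  let φ : (Fin d → ℤ) → L := fun y => ⟨fun i => (y i : ℝ), hmem y⟩
  have hφ : Function.Injective φ := by
    intro y y' h
    have h' := congrArg Subtype.val h
    funext i
    have h2 : (y i : ℝ) = y' i := congrFun h' i
    exact_mod_cast h2
  have hnorm : ∀ y, ‖φ y‖ = ‖y‖ := by
    intro y
    change ‖(fun i => (y i : ℝ))‖ = ‖y‖
    simp only [Pi.norm_def]
    congr 2
  have h1 : Summable fun y : Fin d → ℤ => ‖y‖ ^ r := by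
    refine (hL.comp_injective hφ).congr fun y => ?_
    simp only [Function.comp, hnorm]
  have h2 : Summable fun y : Fin d → ℤ => if y = 0 then (1 : ℝ) else 0 :=
    summable_of_hasFiniteSupport ((Set.finite_singleton 0).subset fun y hy => by
      simpa using hy)
  refine Summable.of_nonneg_of_le (fun y => by positivity) (fun y => ?_) (h1.add h2)
  have hd' : (0 : ℝ) < d := by exact_mod_cast hd
  have hr0 : r < 0 := by linarith
  by_cases hy : y = 0
  · simp [hy, Real.zero_rpow hr0.ne]
  · simp only [hy, if_false, add_zero]
    exact Real.rpow_le_rpow_of_nonpos (norm_pos_iff.mpr hy) (by linarith) hr0.le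

/-- Fibrewise comparison: a sum over a set that maps to `ℤ^d` with fibres growing slower than
`‖y‖^{2/3}` is controlled by a lattice sum. -/
lemma sum_le_of_card_fiber_le {X : Type*} {d k : ℕ} (hd0 : 0 < d) (hd : d < k) {K : ℝ}
    (W : X → ℝ) (φ : X → Fin d → ℤ) (T : Finset X)
    (hW : ∀ x ∈ T, 1 + ‖φ x‖ ≤ W x)
    (hcard : ∀ y, ∀ s ⊆ T, (∀ x ∈ s, φ x = y) → (s.card : ℝ) ^ 3 ≤ (K * (1 + ‖y‖)) ^ 2) :
    ∑ x ∈ T, (W x ^ k)⁻¹ ≤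
      ∑' y : Fin d → ℤ, (K ^ 2) ^ (1 / 3 : ℝ) * (1 + ‖y‖) ^ (2 / 3 - k : ℝ) := by
  classical
  have hsum : Summable fun y : Fin d → ℤ =>
      (K ^ 2) ^ (1 / 3 : ℝ) * (1 + ‖y‖) ^ (2 / 3 - k : ℝ) := by
    refine (summable_one_add_norm_rpow d _ hd0 ?_).mul_left _
    have : (d : ℝ) + 1 ≤ k := by exact_mod_cast hd
    linarith
  rw [← Finset.sum_fiberwise_of_maps_to (g := φ) (t := T.image φ)
    (fun x hx => Finset.mem_image_of_mem φ hx)]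
  refine (Finset.sum_le_sum fun y _ => ?_).trans
    (hsum.sum_le_tsum _ fun y _ => by positivity)
  set s := T.filter (fun x => φ x = y)
  have hpos : (0 : ℝ) < 1 + ‖y‖ := by positivity
  have h1 : ∀ x ∈ s, (W x ^ k)⁻¹ ≤ ((1 + ‖y‖) ^ k)⁻¹ := by
    intro x hx
    obtain ⟨hxT, hxy⟩ := Finset.mem_filter.mp hx
    have := hW x hxT
    rw [hxy] at this
    gcongr
  have h2 := hcard y s (Finset.filter_subset _ _) fun x hx => (Finset.mem_filter.mp hx).2
  have h3 : (s.card : ℝ) ≤ (K ^ 2) ^ (1 / 3 : ℝ) * (1 + ‖y‖) ^ (2 / 3 : ℝ) := by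
    calc (s.card : ℝ) = ((s.card : ℝ) ^ 3) ^ (1 / 3 : ℝ) := by
          rw [← Real.rpow_natCast, ← Real.rpow_mul (by positivity)]; norm_num
      _ ≤ ((K * (1 + ‖y‖)) ^ 2) ^ (1 / 3 : ℝ) := by gcongr
      _ = _ := by
          rw [mul_pow, Real.mul_rpow (by positivity) (by positivity),
            ← Real.rpow_natCast (1 + ‖y‖), ← Real.rpow_mul hpos.le]; norm_num
  calc ∑ x ∈ s, (W x ^ k)⁻¹ ≤ s.card • ((1 + ‖y‖) ^ k)⁻¹ := Finset.sum_le_card_nsmul _ _ _ h1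
    _ = (s.card : ℝ) * ((1 + ‖y‖) ^ k)⁻¹ := nsmul_eq_mul _ _
    _ ≤ ((K ^ 2) ^ (1 / 3 : ℝ) * (1 + ‖y‖) ^ (2 / 3 : ℝ)) * ((1 + ‖y‖) ^ k)⁻¹ := by gcongr
    _ = _ := by rw [mul_assoc, Real.rpow_sub hpos, Real.rpow_natCast, ← div_eq_mul_inv]

lemma one_add_norm_cons_cons_le {n : ℕ} (b c : ℤ) (v : Fin n → ℤ) {W : ℝ}
    (hb : 1 + |(b : ℝ)| ≤ W) (hc : 1 + |(c : ℝ)| ≤ W) (hv : 1 + ‖v‖ ≤ W) :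
    1 + ‖(Fin.cons b (Fin.cons c v : Fin (n + 1) → ℤ) : Fin (n + 2) → ℤ)‖ ≤ W := by
  have hW : 0 ≤ W - 1 := by linarith [abs_nonneg (b : ℝ)]
  suffices ‖(Fin.cons b (Fin.cons c v : Fin (n + 1) → ℤ) : Fin (n + 2) → ℤ)‖ ≤ W - 1 by linarith
  rw [pi_norm_le_iff_of_nonneg hW]
  intro i
  refine Fin.cases ?_ (fun i => Fin.cases ?_ (fun i => ?_) i) i
  · simpa [Int.norm_eq_abs] using by linarith
  · simpa [Int.norm_eq_abs] using by linarith
  · simpa using (norm_le_pi_norm v i).trans (by linarith)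

lemma le_norm_cons_cons {n : ℕ} (b c : ℤ) (v : Fin n → ℤ) :
    |(b : ℝ)| ≤ ‖(Fin.cons b (Fin.cons c v : Fin (n + 1) → ℤ) : Fin (n + 2) → ℤ)‖ ∧
    |(c : ℝ)| ≤ ‖(Fin.cons b (Fin.cons c v : Fin (n + 1) → ℤ) : Fin (n + 2) → ℤ)‖ ∧
    ‖v‖ ≤ ‖(Fin.cons b (Fin.cons c v : Fin (n + 1) → ℤ) : Fin (n + 2) → ℤ)‖ := by
  set w : Fin (n + 2) → ℤ := Fin.cons b (Fin.cons c v : Fin (n + 1) → ℤ)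
  refine ⟨?_, ?_, ?_⟩
  · simpa [w, Int.norm_eq_abs] using norm_le_pi_norm w 0
  · simpa [w, Int.norm_eq_abs] using norm_le_pi_norm w (Fin.succ 0)
  · rw [pi_norm_le_iff_of_nonneg (norm_nonneg _)]
    intro i
    simpa [w] using norm_le_pi_norm w i.succ.succ

lemma cons_cons_inj {n : ℕ} {b c b' c' : ℤ} {v v' : Fin n → ℤ}
    (h : (Fin.cons b (Fin.cons c v : Fin (n + 1) → ℤ) : Fin (n + 2) → ℤ) =
      Fin.cons b' (Fin.cons c' v' : Fin (n + 1) → ℤ)) : b = b' ∧ c = c' ∧ v = v' := by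
  obtain ⟨h1, h2⟩ := Fin.cons_injective2 h
  exact ⟨h1, Fin.cons_injective2 h2⟩

/-- Integral points of `ae + bc = q(v)` with `ae ≠ 0` contribute a bounded amount. -/
lemma sum_le_of_mul_ne_zero {n k : ℕ} (hk : n + 2 < k) {q : (Fin n → ℤ) → ℝ} {C : ℝ}
    (hC : 0 ≤ C) (hq : ∀ v, |q v| ≤ C * (1 + ‖v‖) ^ 2) {X : Type*} (a b c e : X → ℤ)
    (v : X → Fin n → ℤ)
    (hinj : ∀ x y, a x = a y → b x = b y → c x = c y → e x = e y → v x = v y → x = y)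
    (heq : ∀ x, (a x : ℝ) * e x + b x * c x = q (v x)) (W : X → ℝ)
    (hb : ∀ x, 1 + |(b x : ℝ)| ≤ W x) (hc : ∀ x, 1 + |(c x : ℝ)| ≤ W x)
    (hv : ∀ x, 1 + ‖v x‖ ≤ W x) :
    ∃ B : ℝ, ∀ T : Finset X, (∀ x ∈ T, a x * e x ≠ 0) → ∑ x ∈ T, (W x ^ k)⁻¹ ≤ B := by
  classical
  refine ⟨_, fun T hT => sum_le_of_card_fiber_le (d := n + 2) (K := 8 ^ 9 * (C + 1)) (by omega) hk
    W (fun x => Fin.cons (b x) (Fin.cons (c x) (v x) : Fin (n + 1) → ℤ)) T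
    (fun x _ => one_add_norm_cons_cons_le _ _ _ (hb x) (hc x) (hv x)) ?_⟩
  intro y s hs hsy
  rcases s.eq_empty_or_nonempty with rfl | ⟨x₀, hx₀⟩
  · simp; positivity
  have hcoord : ∀ x ∈ s, b x = b x₀ ∧ c x = c x₀ ∧ v x = v x₀ := fun x hx =>
    cons_cons_inj ((hsy x hx).trans (hsy x₀ hx₀).symm)
  have ht : ∀ x ∈ s, a x * e x = a x₀ * e x₀ := by
    intro x hx
    obtain ⟨h1, h2, h3⟩ := hcoord x hx
    have h4 := heq x
    rw [h1, h2, h3, ← heq x₀] at h4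
    have h5 : (a x : ℝ) * e x = a x₀ * e x₀ := by linarith
    exact_mod_cast h5
  have hne := hT x₀ (hs hx₀)
  have hinjOn : Set.InjOn a s := by
    intro x hx x' hx' haa
    obtain ⟨h1, h2, h3⟩ := hcoord x hx
    obtain ⟨h1', h2', h3'⟩ := hcoord x' hx'
    have ha : a x ≠ 0 := left_ne_zero_of_mul (hT x (hs hx))
    have he : a x * e x = a x * e x' := by rw [ht x hx, haa, ht x' hx']
    exact hinj x x' haa (h1.trans h1'.symm) (h2.trans h2'.symm) (mul_left_cancel₀ ha he)
      (h3.trans h3'.symm)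
  have hcard := card_le_of_forall_dvd hne (s.image a) (by
    intro z hz
    obtain ⟨x, hx, rfl⟩ := Finset.mem_image.mp hz
    exact ⟨e x, (ht x hx).symm⟩)
  rw [Finset.card_image_of_injOn hinjOn] at hcard
  obtain ⟨n1, n2, n3⟩ := le_norm_cons_cons (b x₀) (c x₀) (v x₀)
  have hy : (Fin.cons (b x₀) (Fin.cons (c x₀) (v x₀) : Fin (n + 1) → ℤ) : Fin (n + 2) → ℤ) = y :=
    hsy x₀ hx₀
  rw [hy] at n1 n2 n3
  have hY : 0 ≤ ‖y‖ := norm_nonneg y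
  have ht1 : |((a x₀ * e x₀ : ℤ) : ℝ)| ≤ (C + 1) * (1 + ‖y‖) ^ 2 := by
    have h1 : ((a x₀ * e x₀ : ℤ) : ℝ) = q (v x₀) - b x₀ * c x₀ := by
      push_cast; linarith [heq x₀]
    rw [h1]
    calc |q (v x₀) - b x₀ * c x₀| ≤ |q (v x₀)| + |(b x₀ : ℝ)| * |(c x₀ : ℝ)| := by
          rw [← abs_mul]; exact abs_sub _ _
      _ ≤ C * (1 + ‖y‖) ^ 2 + ‖y‖ * ‖y‖ := by
          refine add_le_add ((hq _).trans ?_) (mul_le_mul n1 n2 (abs_nonneg _) hY)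
          gcongr
      _ ≤ _ := by nlinarith
  calc (s.card : ℝ) ^ 3 ≤ 8 ^ 9 * |((a x₀ * e x₀ : ℤ) : ℝ)| := hcard
    _ ≤ 8 ^ 9 * ((C + 1) * (1 + ‖y‖) ^ 2) := by gcongr
    _ = (8 ^ 9 * (C + 1)) * (1 + ‖y‖) ^ 2 := by ring
    _ ≤ (8 ^ 9 * (C + 1)) ^ 2 * (1 + ‖y‖) ^ 2 := by
      gcongr
      have : (1 : ℝ) ≤ 8 ^ 9 * (C + 1) := by linarith
      nlinarith
    _ = _ := by ring

/-- Integral points of `ae + bc = q(v)` with `ae = bc = 0` contribute a bounded amount. -/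
lemma sum_le_of_mul_eq_zero {n k : ℕ} (hk : n + 2 < k) {q : (Fin n → ℤ) → ℝ}
    (hq0 : ∀ v w, q v = 0 → q w = 0 → v = w) {X : Type*} (a b c e : X → ℤ)
    (v : X → Fin n → ℤ)
    (hinj : ∀ x y, a x = a y → b x = b y → c x = c y → e x = e y → v x = v y → x = y)
    (heq : ∀ x, (a x : ℝ) * e x + b x * c x = q (v x)) (W : X → ℝ)
    (ha : ∀ x, 1 + |(a x : ℝ)| ≤ W x) (he : ∀ x, 1 + |(e x : ℝ)| ≤ W x)
    (hb : ∀ x, 1 + |(b x : ℝ)| ≤ W x) (hc : ∀ x, 1 + |(c x : ℝ)| ≤ W x)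
    (hv : ∀ x, 1 + ‖v x‖ ≤ W x) :
    ∃ B : ℝ, ∀ T : Finset X, (∀ x ∈ T, a x * e x = 0 ∧ b x * c x = 0) →
      ∑ x ∈ T, (W x ^ k)⁻¹ ≤ B := by
  classical
  have hadd : ∀ (p r : ℤ) (w : ℝ), p * r = 0 → 1 + |(p : ℝ)| ≤ w → 1 + |(r : ℝ)| ≤ w →
      1 + |((p + r : ℤ) : ℝ)| ≤ w := by
    intro p r w h h1 h2
    rcases mul_eq_zero.mp h with rfl | rfl
    · simpa using h2
    · simpa using h1
  refine ⟨_, fun T hT => sum_le_of_card_fiber_le (d := n + 2) (K := 8) (by omega) hk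
    W (fun x => Fin.cons (a x + e x) (Fin.cons (b x + c x) (v x) : Fin (n + 1) → ℤ)) T
    (fun x hx => one_add_norm_cons_cons_le _ _ _ (hadd _ _ _ (hT x hx).1 (ha x) (he x))
      (hadd _ _ _ (hT x hx).2 (hb x) (hc x)) (hv x)) ?_⟩
  intro y s hs hsy
  have hinjOn : Set.InjOn (fun x => (decide (a x = 0), decide (b x = 0))) (s : Set X) := by
    intro x hx x' hx' h
    obtain ⟨h1, h2, -⟩ := cons_cons_inj ((hsy x hx).trans (hsy x' hx').symm)
    obtain ⟨hx1, hx2⟩ := hT x (hs hx)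
    obtain ⟨hx1', hx2'⟩ := hT x' (hs hx')
    simp only [Prod.mk.injEq, decide_eq_decide] at h
    have key : ∀ p r p' r' : ℤ, p * r = 0 → p' * r' = 0 → (p = 0 ↔ p' = 0) → p + r = p' + r' →
        p = p' ∧ r = r' := by
      intro p r p' r' h1 h2 h3 h4
      by_cases hp : p = 0
      · have := h3.mp hp; omega
      · have hr := (mul_eq_zero.mp h1).resolve_left hp
        have hr' := (mul_eq_zero.mp h2).resolve_left fun h => hp (h3.mpr h)
        omega
    obtain ⟨e1, e2⟩ := key _ _ _ _ hx1 hx1' h.1 h1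
    obtain ⟨e3, e4⟩ := key _ _ _ _ hx2 hx2' h.2 h2
    have hzero : ∀ x ∈ T, q (v x) = 0 := by
      intro x hx
      obtain ⟨g1, g2⟩ := hT x hx
      rw [← heq x]
      have g1' : (a x : ℝ) * e x = 0 := by exact_mod_cast g1
      have g2' : (b x : ℝ) * c x = 0 := by exact_mod_cast g2
      rw [g1', g2', add_zero]
    exact hinj x x' e1 e3 e4 e2 (hq0 _ _ (hzero x (hs hx)) (hzero x' (hs hx')))
  have hcard : s.card ≤ 4 := by
    rw [← Finset.card_image_of_injOn hinjOn]
    exact (Finset.card_le_univ _).trans (by simp)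
  have h4 : (s.card : ℝ) ≤ 4 := by exact_mod_cast hcard
  have hY : 0 ≤ ‖y‖ := norm_nonneg y
  calc (s.card : ℝ) ^ 3 ≤ 4 ^ 3 := by gcongr
    _ ≤ (8 * (1 + ‖y‖)) ^ 2 := by nlinarith

lemma summable_of_hyperbolic_eq {n k : ℕ} (hk : n + 2 < k) {q : (Fin n → ℤ) → ℝ} {C : ℝ}
    (hC : 0 ≤ C) (hq : ∀ v, |q v| ≤ C * (1 + ‖v‖) ^ 2)
    (hq0 : ∀ v w, q v = 0 → q w = 0 → v = w) {X : Type*} (a b c e : X → ℤ)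
    (v : X → Fin n → ℤ)
    (hinj : ∀ x y, a x = a y → b x = b y → c x = c y → e x = e y → v x = v y → x = y)
    (heq : ∀ x, (a x : ℝ) * e x + b x * c x = q (v x)) (W : X → ℝ)
    (ha : ∀ x, 1 + |(a x : ℝ)| ≤ W x) (he : ∀ x, 1 + |(e x : ℝ)| ≤ W x)
    (hb : ∀ x, 1 + |(b x : ℝ)| ≤ W x) (hc : ∀ x, 1 + |(c x : ℝ)| ≤ W x)
    (hv : ∀ x, 1 + ‖v x‖ ≤ W x) :
    Summable fun x => (W x ^ k)⁻¹ := by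
  classical
  obtain ⟨B₁, h₁⟩ := sum_le_of_mul_ne_zero hk hC hq a b c e v hinj heq W hb hc hv
  obtain ⟨B₂, h₂⟩ := sum_le_of_mul_ne_zero hk hC hq b a e c v
    (fun x y g1 g2 g3 g4 g5 => hinj x y g2 g1 g4 g3 g5) (fun x => by rw [← heq x]; ring) W ha he hv
  obtain ⟨B₃, h₃⟩ := sum_le_of_mul_eq_zero hk hq0 a b c e v hinj heq W ha he hb hc hv
  have hW : ∀ x, 0 ≤ W x := fun x => by linarith [ha x, abs_nonneg (a x : ℝ)]
  refine summable_of_sum_le (c := B₁ + (B₂ + B₃)) (fun x => by have := hW x; positivity) fun T => ?_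
  rw [← Finset.sum_filter_add_sum_filter_not T (fun x => a x * e x ≠ 0),
    ← Finset.sum_filter_add_sum_filter_not (T.filter fun x => ¬ a x * e x ≠ 0)
      (fun x => b x * c x ≠ 0)]
  refine add_le_add (h₁ _ ?_) (add_le_add (h₂ _ ?_) (h₃ _ ?_))
  · intro x hx; exact (Finset.mem_filter.mp hx).2
  · intro x hx; exact (Finset.mem_filter.mp hx).2
  · intro x hx
    simp only [Finset.mem_filter, not_not] at hx
    exact ⟨hx.1.2, hx.2⟩

namespace OEis

section Forms

variable {m : ℕ} {K : Type} [Field K]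

lemma bilin_add_left (A : Matrix (Fin m) (Fin m) ℤ) (u u' v : Fin m → K) :
    bilin K A (u + u') v = bilin K A u v + bilin K A u' v := add_dotProduct _ _ _

lemma bilin_add_right (A : Matrix (Fin m) (Fin m) ℤ) (u v v' : Fin m → K) :
    bilin K A u (v + v') = bilin K A u v + bilin K A u v' := by
  simp only [bilin, mulVec_add, dotProduct_add]

lemma bilin_smul_left (A : Matrix (Fin m) (Fin m) ℤ) (t : K) (u v : Fin m → K) :
    bilin K A (t • u) v = t * bilin K A u v := smul_dotProduct _ _ _

lemma bilin_smul_right (A : Matrix (Fin m) (Fin m) ℤ) (t : K) (u v : Fin m → K) :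
    bilin K A u (t • v) = t * bilin K A u v := by
  simp only [bilin, mulVec_smul, dotProduct_smul, smul_eq_mul]

lemma bilin_neg (A : Matrix (Fin m) (Fin m) ℤ) (u v : Fin m → K) :
    bilin K (-A) u v = -bilin K A u v := by
  have : (-A).map (Int.cast : ℤ → K) = -A.map Int.cast := by ext; simp
  simp only [bilin, this, neg_mulVec, dotProduct_neg]

lemma bilin_comm {A : Matrix (Fin m) (Fin m) ℤ} (hA : A.IsSymm) (u v : Fin m → K) :
    bilin K A u v = bilin K A v u := by
  have hA' : (A.map (Int.cast : ℤ → K))ᵀ = A.map Int.cast := by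
    rw [← transpose_map, hA.eq]
  rw [bilin, dotProduct_mulVec, ← mulVec_transpose, hA', dotProduct_comm, bilin]

lemma bilin_map {L : Type} [Field L] (f : K →+* L) (A : Matrix (Fin m) (Fin m) ℤ)
    (u v : Fin m → K) : bilin L A (f ∘ u) (f ∘ v) = f (bilin K A u v) := by
  simp [bilin, dotProduct, mulVec]

lemma bilin_mulVec_mulVec {A : Matrix (Fin m) (Fin m) ℤ} {M : Matrix (Fin m) (Fin m) K}
    (hM : Mᵀ * A.map (Int.cast : ℤ → K) * M = A.map Int.cast) (u v : Fin m → K) :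
    bilin K A (M *ᵥ u) (M *ᵥ v) = bilin K A u v := by
  have h : (A.map (Int.cast : ℤ → K)) *ᵥ v = Mᵀ *ᵥ (A.map Int.cast *ᵥ (M *ᵥ v)) := by
    rw [mulVec_mulVec, mulVec_mulVec, hM]
  rw [bilin, bilin, h, dotProduct_mulVec u, vecMul_transpose]

lemma forall_fin_add_two {P : Fin (m + 2) → Prop} (h0 : P ⟨0, by omega⟩)
    (hm : ∀ i : Fin m, P ⟨(i : ℕ) + 1, by have := i.isLt; omega⟩)
    (hl : P ⟨m + 1, by omega⟩) (i : Fin (m + 2)) : P i := by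
  refine Fin.cases h0 (fun i => ?_) i
  exact Fin.lastCases hl hm i

lemma sum_fin_add_two {M : Type*} [AddCommMonoid M] (f : Fin (m + 2) → M) :
    ∑ i, f i = f ⟨0, by omega⟩ + (∑ i : Fin m, f ⟨(i : ℕ) + 1, by have := i.isLt; omega⟩
      + f ⟨m + 1, by omega⟩) := by
  rw [Fin.sum_univ_succ, Fin.sum_univ_castSucc]
  rfl

lemma vec_ext {L : Type} {u v : Fin (m + 2) → L} (h0 : vfirst u = vfirst v)
    (hm : vmid u = vmid v) (hl : vlast u = vlast v) : u = v :=
  funext (forall_fin_add_two h0 (congrFun hm) hl)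

/-- The vector with given first entry, middle part and last entry. -/
def consSnoc {L : Type} (a : L) (v : Fin m → L) (b : L) : Fin (m + 2) → L :=
  Fin.cons a (Fin.snoc v b : Fin (m + 1) → L)

@[simp] lemma vfirst_consSnoc {L : Type} (a : L) (v : Fin m → L) (b : L) :
    vfirst (consSnoc a v b) = a := rfl

@[simp] lemma vmid_consSnoc {L : Type} (a : L) (v : Fin m → L) (b : L) :
    vmid (consSnoc a v b) = v := by
  funext i
  change (Fin.cons a (Fin.snoc v b : Fin (m + 1) → L) : Fin (m + 2) → L) i.castSucc.succ = v i
  rw [Fin.cons_succ, Fin.snoc_castSucc (α := fun _ => L)]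

@[simp] lemma vlast_consSnoc {L : Type} (a : L) (v : Fin m → L) (b : L) :
    vlast (consSnoc a v b) = b := by
  change (Fin.cons a (Fin.snoc v b : Fin (m + 1) → L) : Fin (m + 2) → L) (Fin.last m).succ = b
  rw [Fin.cons_succ, Fin.snoc_last (α := fun _ => L)]

lemma vfirst_hyp_mulVec (A : Matrix (Fin m) (Fin m) ℤ) (v : Fin (m + 2) → K) :
    vfirst (((hyp A).map (Int.cast : ℤ → K)) *ᵥ v) = vlast v := by
  simp only [vfirst, mulVec, dotProduct, sum_fin_add_two]
  simp [hyp, vlast, fun i : Fin m => i.isLt.ne]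

lemma vlast_hyp_mulVec (A : Matrix (Fin m) (Fin m) ℤ) (v : Fin (m + 2) → K) :
    vlast (((hyp A).map (Int.cast : ℤ → K)) *ᵥ v) = vfirst v := by
  simp only [vlast, mulVec, dotProduct, sum_fin_add_two]
  simp [hyp, vfirst]

lemma vmid_hyp_mulVec (A : Matrix (Fin m) (Fin m) ℤ) (v : Fin (m + 2) → K) :
    vmid (((hyp A).map (Int.cast : ℤ → K)) *ᵥ v) = (A.map (Int.cast : ℤ → K)) *ᵥ vmid v := by
  funext i
  simp only [vmid, mulVec, dotProduct, sum_fin_add_two]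
  simp [hyp, fun i : Fin m => i.isLt.ne]

lemma bilin_hyp (A : Matrix (Fin m) (Fin m) ℤ) (u v : Fin (m + 2) → K) :
    bilin K (hyp A) u v =
      vfirst u * vlast v + bilin K A (vmid u) (vmid v) + vlast u * vfirst v := by
  rw [bilin, dotProduct, sum_fin_add_two]
  set w := ((hyp A).map (Int.cast : ℤ → K)) *ᵥ v with hw
  change vfirst u * vfirst w + (∑ i, vmid u i * vmid w i + vlast u * vlast w) = _
  rw [hw, vfirst_hyp_mulVec, vlast_hyp_mulVec, vmid_hyp_mulVec, bilin, dotProduct]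
  ring

lemma isSymm_hyp {A : Matrix (Fin m) (Fin m) ℤ} (hA : A.IsSymm) : (hyp A).IsSymm := by
  refine IsSymm.ext fun i j => ?_
  simp only [hyp]
  split_ifs <;> first | rfl | omega | exact hA.apply _ _

lemma hyp_mulVec_eq_zero {A : Matrix (Fin m) (Fin m) ℤ}
    (hA : ∀ v : Fin m → K, (A.map (Int.cast : ℤ → K)) *ᵥ v = 0 → v = 0) (v : Fin (m + 2) → K)
    (hv : ((hyp A).map (Int.cast : ℤ → K)) *ᵥ v = 0) : v = 0 := by
  have h1 := vfirst_hyp_mulVec A v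
  have h2 := vlast_hyp_mulVec A v
  have h3 := vmid_hyp_mulVec A v
  rw [hv] at h1 h2 h3
  exact vec_ext h2.symm (hA _ h3.symm) h1.symm

lemma bilin_complex (A : Matrix (Fin m) (Fin m) ℤ) (w w' : Fin m → ℂ) :
    bilin ℂ A w w' =
      ((bilin ℝ A (fun i => (w i).re) (fun i => (w' i).re)
        - bilin ℝ A (fun i => (w i).im) (fun i => (w' i).im) : ℝ) : ℂ)
      + ((bilin ℝ A (fun i => (w i).re) (fun i => (w' i).im)
        + bilin ℝ A (fun i => (w i).im) (fun i => (w' i).re) : ℝ) : ℂ) * I := by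
  have hw : ∀ w : Fin m → ℂ, w =
      Complex.ofRealHom ∘ (fun i => (w i).re) + I • (Complex.ofRealHom ∘ (fun i => (w i).im)) := by
    intro w
    funext i
    simp [mul_comm I]
  conv_lhs => rw [hw w, hw w']
  simp only [bilin_add_left, bilin_add_right, bilin_smul_left, bilin_smul_right, bilin_map]
  simp only [ofRealHom_eq_coe]
  push_cast
  linear_combination (bilin ℝ A (fun i => (w i).im) (fun i => (w' i).im) : ℂ) * I_mul_I

lemma bilin_self_re {A : Matrix (Fin m) (Fin m) ℤ} (w : Fin m → ℂ) :
    (bilin ℂ A w w).re = bilin ℝ A (fun i => (w i).re) (fun i => (w i).re)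
        - bilin ℝ A (fun i => (w i).im) (fun i => (w i).im) := by
  rw [bilin_complex]; simp

lemma bilin_self_im {A : Matrix (Fin m) (Fin m) ℤ} (hA : A.IsSymm) (w : Fin m → ℂ) :
    (bilin ℂ A w w).im = 2 * bilin ℝ A (fun i => (w i).re) (fun i => (w i).im) := by
  rw [bilin_complex, bilin_comm hA (fun i => (w i).im) (fun i => (w i).re)]; simp; ring

lemma bilin_star_self {A : Matrix (Fin m) (Fin m) ℤ} (hA : A.IsSymm) (w : Fin m → ℂ) :
    bilin ℂ A w (star w) = ((bilin ℝ A (fun i => (w i).re) (fun i => (w i).re)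
        + bilin ℝ A (fun i => (w i).im) (fun i => (w i).im) : ℝ) : ℂ) := by
  rw [bilin_complex, bilin_comm hA (fun i => (w i).im) (fun i => ((star w) i).re)]
  have h1 : (fun i => ((star w) i).re) = fun i => (w i).re := by funext i; simp
  have h2 : (fun i => ((star w) i).im) = (-1 : ℝ) • fun i => (w i).im := by funext i; simp
  rw [h1, h2, bilin_smul_right, bilin_smul_right]
  push_cast
  ring

end Forms

section Lorentz

variable {n : ℕ} {S : Matrix (Fin n) (Fin n) ℤ}

lemma bilin_MatS0 {K : Type} [Field K] (u v : Fin (n + 2) → K) :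
    bilin K (MatS0 n S) u v =
      vfirst u * vlast v - bilin K S (vmid u) (vmid v) + vlast u * vfirst v := by
  rw [MatS0, bilin_hyp, bilin_neg]; ring

lemma bilin_MatS1 {K : Type} [Field K] (u v : Fin (n + 4) → K) :
    bilin K (MatS1 n S) u v =
      vfirst u * vlast v + bilin K (MatS0 n S) (vmid u) (vmid v) + vlast u * vfirst v :=
  bilin_hyp _ _ _

lemma isSymm_MatS0 (hS : S.IsSymm) : (MatS0 n S).IsSymm :=
  isSymm_hyp (by rw [IsSymm, transpose_neg, hS.eq])

lemma isSymm_MatS1 (hS : S.IsSymm) : (MatS1 n S).IsSymm := isSymm_hyp (isSymm_MatS0 hS)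

lemma bilin_self_nonneg (hpos : ∀ v : Fin n → ℝ, v ≠ 0 → 0 < bilin ℝ S v v) (v : Fin n → ℝ) :
    0 ≤ bilin ℝ S v v := by
  by_cases hv : v = 0
  · simp [hv, bilin]
  · exact (hpos v hv).le

lemma bilin_sq_le (hS : S.IsSymm) (hpos : ∀ v : Fin n → ℝ, v ≠ 0 → 0 < bilin ℝ S v v)
    (u v : Fin n → ℝ) : bilin ℝ S u v ^ 2 ≤ bilin ℝ S u u * bilin ℝ S v v := by
  by_cases hv : v = 0
  · simp [hv, bilin]
  have hvv := hpos v hv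
  have h := bilin_self_nonneg hpos (bilin ℝ S v v • u + (-bilin ℝ S u v) • v)
  simp only [bilin_add_left, bilin_add_right, bilin_smul_left, bilin_smul_right,
    bilin_comm hS v u] at h
  have h' : 0 ≤ bilin ℝ S v v * (bilin ℝ S u u * bilin ℝ S v v - bilin ℝ S u v ^ 2) := by
    linarith
  linarith [nonneg_of_mul_nonneg_right h' hvv]

/-- In a Lorentzian space, a vector orthogonal to a timelike vector and of nonnegative norm
vanishes. -/
lemma eq_zero_of_orthogonal (hS : S.IsSymm)
    (hpos : ∀ v : Fin n → ℝ, v ≠ 0 → 0 < bilin ℝ S v v) {y e : Fin (n + 2) → ℝ}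
    (hy : 0 < bilin ℝ (MatS0 n S) y y) (hey : bilin ℝ (MatS0 n S) e y = 0)
    (he : 0 ≤ bilin ℝ (MatS0 n S) e e) : e = 0 := by
  rw [bilin_MatS0] at hy hey he
  have hcs := bilin_sq_le hS hpos (vmid e) (vmid y)
  have hy' := bilin_self_nonneg hpos (vmid y)
  have he' := bilin_self_nonneg hpos (vmid e)
  set a := vfirst e
  set b := vlast e
  set p := vfirst y
  set r := vlast y
  have hpr : 0 < p * r := by linarith
  have h1 : bilin ℝ S (vmid e) (vmid y) = a * r + b * p := by linarith
  rw [h1] at hcs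
  have h2 : bilin ℝ S (vmid e) (vmid e) = 0 := by
    by_contra hne
    have hlt := lt_of_le_of_ne he' (Ne.symm hne)
    nlinarith [sq_nonneg (a * r - b * p), mul_pos hlt hy, mul_nonneg hpr.le
      (show 0 ≤ 2 * (a * b) - bilin ℝ S (vmid e) (vmid e) by linarith)]
  have hmid : vmid e = 0 := by
    by_contra hne
    exact (hpos _ hne).ne' h2
  have h3 : a * r + b * p = 0 := by
    rw [h2, zero_mul] at hcs
    exact pow_eq_zero_iff (two_ne_zero) |>.mp (le_antisymm hcs (sq_nonneg _))
  have hab : 0 ≤ a * b := by linarith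
  have hp : p ≠ 0 := left_ne_zero_of_mul hpr.ne'
  have hr : r ≠ 0 := right_ne_zero_of_mul hpr.ne'
  have ha : a = 0 := by
    have h4 : a ^ 2 * (p * r) ≤ 0 := by
      have : a ^ 2 * (p * r) = -(a * b) * p ^ 2 := by linear_combination a * p * h3
      rw [this]; nlinarith [mul_nonneg hab (sq_nonneg p)]
    have h5 : a ^ 2 ≤ 0 := by
      by_contra h; push Not at h; nlinarith [mul_pos h hpr]
    exact pow_eq_zero_iff (two_ne_zero) |>.mp (le_antisymm h5 (sq_nonneg _))
  have hb : b = 0 := by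
    rw [ha, zero_mul, zero_add] at h3
    exact (mul_eq_zero.mp h3).resolve_right hp
  exact vec_ext ha hmid hb

/-- The isotropic vector `(-Q₀(z), z, 1)` lifting a point `z`. -/
noncomputable def isoLift (n : ℕ) (S : Matrix (Fin n) (Fin n) ℤ) (z : Fin (n + 2) → ℂ) :
    Fin (n + 4) → ℂ :=
  consSnoc (-quadF ℂ (MatS0 n S) z) z 1

lemma bilin_isoLift_self (z : Fin (n + 2) → ℂ) :
    bilin ℂ (MatS1 n S) (isoLift n S z) (isoLift n S z) = 0 := by
  simp only [bilin_MatS1, isoLift, vfirst_consSnoc, vmid_consSnoc, vlast_consSnoc, quadF]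
  ring

lemma bilin_isoLift_star (hS : S.IsSymm) (z : Fin (n + 2) → ℂ) :
    (bilin ℂ (MatS1 n S) (isoLift n S z) (star (isoLift n S z))).re =
      2 * bilin ℝ (MatS0 n S) (fun i => (z i).im) (fun i => (z i).im) := by
  have h1 : vfirst (star (isoLift n S z)) = star (-quadF ℂ (MatS0 n S) z) := rfl
  have h2 : vmid (star (isoLift n S z)) = star z := by
    change star (vmid (isoLift n S z)) = _
    rw [isoLift, vmid_consSnoc]
  have h3 : vlast (star (isoLift n S z)) = 1 := by
    change star (vlast (isoLift n S z)) = _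
    rw [isoLift, vlast_consSnoc, star_one]
  rw [bilin_MatS1, h1, h2, h3]
  simp only [isoLift, vfirst_consSnoc, vmid_consSnoc, vlast_consSnoc]
  rw [bilin_star_self (isSymm_MatS0 hS)]
  have h4 : (quadF ℂ (MatS0 n S) z).re = (bilin ℂ (MatS0 n S) z z).re / 2 := by
    simp [quadF]
  simp only [mul_one, one_mul, add_re, neg_re, ofReal_re, star_def, conj_re, h4, bilin_self_re]
  ring

lemma vlast_ne_zero (hS : S.IsSymm) (hpos : ∀ v : Fin n → ℝ, v ≠ 0 → 0 < bilin ℝ S v v)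
    {w : Fin (n + 4) → ℂ} (hw : bilin ℂ (MatS1 n S) w w = 0)
    (hw' : 0 < (bilin ℂ (MatS1 n S) w (star w)).re) : vlast w ≠ 0 := by
  intro h0
  have h0' : vlast (star w) = 0 := by
    change star (vlast w) = 0
    rw [h0, star_zero]
  have hmid : vmid (star w) = star (vmid w) := rfl
  rw [bilin_MatS1, h0, mul_zero, zero_mul, zero_add, add_zero] at hw
  rw [bilin_MatS1, h0, h0', mul_zero, zero_mul, zero_add, add_zero, hmid,
    bilin_star_self (isSymm_MatS0 hS), ofReal_re] at hw'
  have hre := bilin_self_re (A := MatS0 n S) (vmid w)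
  have him := bilin_self_im (isSymm_MatS0 hS) (vmid w)
  rw [hw, zero_re] at hre
  rw [hw, zero_im] at him
  have h := eq_zero_of_orthogonal hS hpos (y := fun i => (vmid w i).im)
    (e := fun i => (vmid w i).re) (by linarith) (by linarith) (by linarith)
  rw [h] at hre hw'
  simp only [bilin, zero_dotProduct] at hre hw'
  linarith

lemma jay_eq_bilin (g : Fin (n + 4) → ℚ) (z : Fin (n + 2) → ℂ) :
    jay n S g z = bilin ℂ (MatS1 n S) (fun i => ((g i : ℝ) : ℂ)) (isoLift n S z) := by
  rw [bilin_MatS1]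
  simp only [isoLift, vfirst_consSnoc, vmid_consSnoc, vlast_consSnoc, jay]
  simp only [vfirst, vlast, ofReal_ratCast]
  have : vmid (fun i => (g i : ℂ)) = fun i => ((vmid g i : ℚ) : ℂ) := rfl
  rw [this]
  ring

lemma bilin_isoLift_ne_zero (hS : S.IsSymm)
    (hpos : ∀ v : Fin n → ℝ, v ≠ 0 → 0 < bilin ℝ S v v) {z : Fin (n + 2) → ℂ}
    (hz : z ∈ HS n S) {h : Fin (n + 4) → ℝ} (hh : bilin ℝ (MatS1 n S) h h = 0) (h0 : h ≠ 0) :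
    bilin ℂ (MatS1 n S) (fun i => (h i : ℂ)) (isoLift n S z) ≠ 0 := by
  intro hj
  apply h0
  set x : Fin (n + 2) → ℝ := fun i => (z i).re with hx
  set y : Fin (n + 2) → ℝ := fun i => (z i).im with hy
  have hS0 := isSymm_MatS0 hS
  have hyy : 0 < bilin ℝ (MatS0 n S) y y := by
    have := hz.1
    rw [quadF] at this
    linarith
  set Γ : ℝ := vlast h with hΓ
  set d : Fin (n + 2) → ℝ := vmid h with hd
  set δ : ℝ := vfirst h with hδ
  rw [bilin_MatS1] at hj hh
  simp only [isoLift, vfirst_consSnoc, vmid_consSnoc, vlast_consSnoc] at hj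
  have e1 : vfirst (fun i => (h i : ℂ)) = (δ : ℂ) := rfl
  have e2 : vlast (fun i => (h i : ℂ)) = (Γ : ℂ) := rfl
  have e3 : vmid (fun i => (h i : ℂ)) = fun i => (d i : ℂ) := rfl
  rw [e1, e2, e3, quadF, bilin_complex, bilin_complex] at hj
  have hre := congrArg Complex.re hj
  have him := congrArg Complex.im hj
  have hz0 : bilin ℝ (MatS0 n S) (fun _ => 0) x = 0 := zero_dotProduct _
  have hz1 : bilin ℝ (MatS0 n S) (fun _ => 0) y = 0 := zero_dotProduct _
  have hxy := bilin_comm hS0 y x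
  simp [← hx, ← hy, hz0, hz1] at hre him
  change δ + bilin ℝ (MatS0 n S) d x + _ = 0 at hre
  change bilin ℝ (MatS0 n S) d y + _ = 0 at him
  have hey : bilin ℝ (MatS0 n S) (d + (-Γ) • x) y = 0 := by
    rw [bilin_add_left, bilin_smul_left]
    linear_combination him + Γ / 2 * hxy
  have hee : bilin ℝ (MatS0 n S) (d + (-Γ) • x) (d + (-Γ) • x) =
      Γ ^ 2 * bilin ℝ (MatS0 n S) y y := by
    simp only [bilin_add_left, bilin_add_right, bilin_smul_left, bilin_smul_right,
      bilin_comm hS0 x d]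
    linear_combination hh - 2 * Γ * hre
  have he := eq_zero_of_orthogonal hS hpos hyy hey (by rw [hee]; positivity)
  have hΓ0 : Γ = 0 := by
    rw [he] at hee
    simp only [bilin, zero_dotProduct] at hee
    have := (mul_eq_zero.mp hee.symm).resolve_right hyy.ne'
    exact pow_eq_zero_iff (two_ne_zero) |>.mp this
  rw [hΓ0, neg_zero, zero_smul, add_zero] at he
  refine vec_ext ?_ he hΓ0
  change δ = 0
  rw [he, hΓ0] at hre
  simpa [bilin] using hre

end Lorentz

section Action

variable {n : ℕ} {S : Matrix (Fin n) (Fin n) ℤ}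

lemma jayM_eq (M : Matrix (Fin (n + 4)) (Fin (n + 4)) ℝ) (z : Fin (n + 2) → ℂ) :
    jayM n S M z = vlast (M.map Complex.ofReal *ᵥ isoLift n S z) := by
  simp only [vlast, mulVec, dotProduct, sum_fin_add_two (m := n + 2)]
  have h1 : isoLift n S z ⟨0, by omega⟩ = -quadF ℂ (MatS0 n S) z := rfl
  have h2 : ∀ i : Fin (n + 2), isoLift n S z ⟨(i : ℕ) + 1, by have := i.isLt; omega⟩ = z i :=
    congrFun (vmid_consSnoc _ _ _)
  have h3 : isoLift n S z ⟨n + 2 + 1, by omega⟩ = 1 := vlast_consSnoc _ _ _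
  simp only [h1, h2, h3, map_apply, jayM]
  ring

lemma actM_eq (M : Matrix (Fin (n + 4)) (Fin (n + 4)) ℝ) (z : Fin (n + 2) → ℂ) :
    actM n S M z = (jayM n S M z)⁻¹ • vmid (M.map Complex.ofReal *ᵥ isoLift n S z) := by
  funext i
  simp only [vmid, Pi.smul_apply, mulVec, dotProduct, sum_fin_add_two (m := n + 2)]
  have h1 : isoLift n S z ⟨0, by omega⟩ = -quadF ℂ (MatS0 n S) z := rfl
  have h2 : ∀ i : Fin (n + 2), isoLift n S z ⟨(i : ℕ) + 1, by have := i.isLt; omega⟩ = z i :=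
    congrFun (vmid_consSnoc _ _ _)
  have h3 : isoLift n S z ⟨n + 2 + 1, by omega⟩ = 1 := vlast_consSnoc _ _ _
  simp only [h1, h2, h3, map_apply, actM, smul_eq_mul]
  ring

lemma map_ofReal_mem {m : ℕ} {A : Matrix (Fin m) (Fin m) ℤ} {M : Matrix (Fin m) (Fin m) ℝ}
    (hM : M ∈ OSet A) :
    (M.map Complex.ofReal)ᵀ * A.map (Int.cast : ℤ → ℂ) * M.map Complex.ofReal =
      A.map Int.cast := by
  have hA : A.map (Int.cast : ℤ → ℂ) = (A.map (Int.cast : ℤ → ℝ)).map Complex.ofRealHom := by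
    ext; simp
  have h := congrArg (fun B => B.map Complex.ofRealHom) (show _ = _ from hM)
  simp only [Matrix.map_mul] at h
  rw [hA]
  exact h

lemma star_map_ofReal_mulVec {m : ℕ} (M : Matrix (Fin m) (Fin m) ℝ) (w : Fin m → ℂ) :
    star (M.map Complex.ofReal *ᵥ w) = M.map Complex.ofReal *ᵥ star w := by
  funext i
  simp [mulVec, dotProduct]

lemma bilin_star_mulVec {M : Matrix (Fin (n + 4)) (Fin (n + 4)) ℝ} (hM : M ∈ OSet (MatS1 n S))
    (w : Fin (n + 4) → ℂ) :
    bilin ℂ (MatS1 n S) (M.map Complex.ofReal *ᵥ w) (star (M.map Complex.ofReal *ᵥ w)) =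
      bilin ℂ (MatS1 n S) w (star w) := by
  rw [star_map_ofReal_mulVec, bilin_mulVec_mulVec (map_ofReal_mem hM)]

lemma jayM_ne_zero (hS : S.IsSymm) (hpos : ∀ v : Fin n → ℝ, v ≠ 0 → 0 < bilin ℝ S v v)
    {M : Matrix (Fin (n + 4)) (Fin (n + 4)) ℝ} (hM : M ∈ OSet (MatS1 n S))
    {z : Fin (n + 2) → ℂ} (hz : z ∈ HS n S) : jayM n S M z ≠ 0 := by
  rw [jayM_eq]
  apply vlast_ne_zero hS hpos
  · rw [bilin_mulVec_mulVec (map_ofReal_mem hM), bilin_isoLift_self]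
  · rw [bilin_star_mulVec hM, bilin_isoLift_star hS]
    have := hz.1
    rw [quadF] at this
    linarith

lemma mulVec_isoLift {M : Matrix (Fin (n + 4)) (Fin (n + 4)) ℝ} (hM : M ∈ OSet (MatS1 n S))
    {z : Fin (n + 2) → ℂ} (hj : jayM n S M z ≠ 0) :
    M.map Complex.ofReal *ᵥ isoLift n S z = jayM n S M z • isoLift n S (actM n S M z) := by
  have hiso : bilin ℂ (MatS1 n S) (M.map Complex.ofReal *ᵥ isoLift n S z)
      (M.map Complex.ofReal *ᵥ isoLift n S z) = 0 := by
    rw [bilin_mulVec_mulVec (map_ofReal_mem hM), bilin_isoLift_self]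
  have hl := jayM_eq (S := S) M z
  have hu := actM_eq (S := S) M z
  set w := M.map Complex.ofReal *ᵥ isoLift n S z
  set j := jayM n S M z
  set u := actM n S M z
  have hm : vmid w = j • u := by rw [hu, smul_inv_smul₀ hj]
  refine vec_ext ?_ ?_ ?_
  · change vfirst w = j * -quadF ℂ (MatS0 n S) u
    rw [bilin_MatS1, hm, bilin_smul_left, bilin_smul_right, ← hl] at hiso
    apply mul_left_cancel₀ hj
    rw [quadF]
    linear_combination hiso / 2
  · change vmid w = j • vmid (isoLift n S u)
    rw [isoLift, vmid_consSnoc, hm]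
  · change vlast w = j * vlast (isoLift n S u)
    rw [isoLift, vlast_consSnoc, mul_one, hl]

lemma quadF_im_actM_pos (hS : S.IsSymm)
    (hpos : ∀ v : Fin n → ℝ, v ≠ 0 → 0 < bilin ℝ S v v)
    {M : Matrix (Fin (n + 4)) (Fin (n + 4)) ℝ} (hM : M ∈ OSet (MatS1 n S))
    {z : Fin (n + 2) → ℂ} (hz : z ∈ HS n S) :
    0 < quadF ℝ (MatS0 n S) (fun i => (actM n S M z i).im) := by
  have hj := jayM_ne_zero hS hpos hM hz
  have h1 := bilin_star_mulVec hM (isoLift n S z)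
  rw [mulVec_isoLift hM hj, star_smul, bilin_smul_left, bilin_smul_right, ← mul_assoc,
    star_def, mul_conj] at h1
  have h2 := congrArg Complex.re h1
  rw [re_ofReal_mul, bilin_isoLift_star hS, bilin_isoLift_star hS] at h2
  have hz1 := hz.1
  rw [quadF] at hz1 ⊢
  have hn : 0 < normSq (jayM n S M z) := normSq_pos.mpr hj
  have h3 : 0 < normSq (jayM n S M z) *
      bilin ℝ (MatS0 n S) (fun i => (actM n S M z i).im) (fun i => (actM n S M z i).im) := by
    linarith
  linarith [pos_of_mul_pos_right h3 hn.le]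

lemma vfirst_ne_zero_of_quadF_pos (hpos : ∀ v : Fin n → ℝ, v ≠ 0 → 0 < bilin ℝ S v v)
    {y : Fin (n + 2) → ℝ} (hy : 0 < quadF ℝ (MatS0 n S) y) : y ⟨0, by omega⟩ ≠ 0 := by
  intro h
  have h' : vfirst y = 0 := h
  rw [quadF, bilin_MatS0, h'] at hy
  linarith [bilin_self_nonneg hpos (vmid y)]

lemma actM_mem_HS (hS : S.IsSymm) (hpos : ∀ v : Fin n → ℝ, v ≠ 0 → 0 < bilin ℝ S v v)
    {M : Matrix (Fin (n + 4)) (Fin (n + 4)) ℝ} (hM : M ∈ OPlus (MatS1 n S))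
    {z : Fin (n + 2) → ℂ} (hz : z ∈ HS n S) : actM n S M z ∈ HS n S := by
  have hsub : OPlus (MatS1 n S) ⊆ OSet (MatS1 n S) := connectedComponentIn_subset _ _
  refine ⟨quadF_im_actM_pos hS hpos (hsub hM) hz, ?_⟩
  have h1 : (1 : Matrix (Fin (n + 4)) (Fin (n + 4)) ℝ) ∈ OSet (MatS1 n S) := by
    simp [OSet]
  have hmem : (1 : Matrix (Fin (n + 4)) (Fin (n + 4)) ℝ) ∈ OPlus (MatS1 n S) :=
    mem_connectedComponentIn h1
  have hone : actM n S 1 z = z := by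
    have hj : jayM n S 1 z = 1 := by
      rw [jayM_eq, Matrix.map_one _ ofReal_zero ofReal_one, one_mulVec, isoLift, vlast_consSnoc]
    rw [actM_eq, hj, Matrix.map_one _ ofReal_zero ofReal_one, one_mulVec, isoLift, vmid_consSnoc,
      inv_one, one_smul]
  have hcont : ContinuousOn (fun M => (actM n S M z ⟨0, by omega⟩).im) (OPlus (MatS1 n S)) := by
    refine Complex.continuous_im.comp_continuousOn ?_
    have hcj : Continuous fun M => jayM n S M z := by unfold jayM; fun_prop
    refine ContinuousOn.mul (Continuous.continuousOn (by fun_prop)) ?_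
    exact hcj.continuousOn.inv₀ fun M hM => jayM_ne_zero hS hpos (hsub hM) hz
  by_contra hneg
  obtain ⟨M', hM', h0⟩ := isPreconnected_connectedComponentIn.intermediate_value hM hmem hcont
    ⟨not_lt.mp hneg, by simpa only [hone] using hz.2.le⟩
  exact vfirst_ne_zero_of_quadF_pos hpos (quadF_im_actM_pos hS hpos (hsub hM') hz) h0

end Action

section Cusp

variable {n : ℕ} {S : Matrix (Fin n) (Fin n) ℤ}

lemma dvd_ratGcd_intCast {m d : ℕ} (W : Fin m → ℤ) :
    d ∣ ratGcd (fun i => (W i : ℚ)) ↔ ∀ i, (d : ℤ) ∣ W i := by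
  simp [ratGcd, Finset.dvd_gcd_iff, Int.natCast_dvd]

lemma map_mulVec_intCast {m : ℕ} {K : Type} [Field K] (A : Matrix (Fin m) (Fin m) ℤ)
    (W : Fin m → ℤ) :
    (A.map (Int.cast : ℤ → K)) *ᵥ (fun i => (W i : K)) = fun i => ((A *ᵥ W) i : K) := by
  funext i
  simp [mulVec, dotProduct]

lemma map_intCast_mul {m : ℕ} {K : Type} [Field K] (A B : Matrix (Fin m) (Fin m) ℤ) :
    (A * B).map (Int.cast : ℤ → K) = A.map Int.cast * B.map Int.cast :=
  Matrix.map_mul (f := Int.castRingHom K)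

lemma map_intCast_one {m : ℕ} {K : Type} [Field K] :
    (1 : Matrix (Fin m) (Fin m) ℤ).map (Int.cast : ℤ → K) = 1 :=
  Matrix.map_one _ Int.cast_zero Int.cast_one

lemma vmid_vmid_stdCuspVec (fc : Fin n → ℚ) : vmid (vmid (stdCuspVec n S fc)) = fc := by
  funext i
  have := i.isLt
  simp [vmid, stdCuspVec, show (i : ℕ) ≠ n by omega, show (i : ℕ) ≠ n + 1 by omega]

lemma exists_int_mulVec_MatS1 {c : Fin (n + 4) → ℚ} (hc : IsStdCusp n S c) :
    ∃ W : Fin (n + 4) → ℤ, (MatS1 n S).map (Int.cast : ℤ → ℚ) *ᵥ c = fun i => (W i : ℚ) := by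
  obtain ⟨fc, hdual, ⟨q, hq⟩, rfl⟩ := hc
  choose w hw using hdual
  have h2 := vmid_vmid_stdCuspVec (S := S) fc
  refine ⟨consSnoc q (consSnoc 0 (-w) 0) 1, vec_ext ?_ (vec_ext ?_ ?_ ?_) ?_⟩
  · rw [MatS1, vfirst_hyp_mulVec]
    change _ = ((q : ℤ) : ℚ)
    rw [← hq]
    simp [vlast, stdCuspVec]
  · rw [MatS1, vmid_hyp_mulVec, MatS0, vfirst_hyp_mulVec]
    change _ = ((vfirst (vmid (consSnoc q (consSnoc 0 (-w) 0) 1)) : ℤ) : ℚ)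
    simp [vlast, vmid, stdCuspVec]
  · rw [MatS1, vmid_hyp_mulVec, MatS0, vmid_hyp_mulVec, h2]
    funext i
    change _ = ((vmid (vmid (consSnoc q (consSnoc 0 (-w) 0) 1)) i : ℤ) : ℚ)
    rw [vmid_consSnoc, vmid_consSnoc, Pi.neg_apply, Int.cast_neg, ← hw]
    simp [mulVec, dotProduct]
  · rw [MatS1, vmid_hyp_mulVec, MatS0, vlast_hyp_mulVec]
    change _ = ((vlast (vmid (consSnoc q (consSnoc 0 (-w) 0) 1)) : ℤ) : ℚ)
    simp [vfirst, vmid, stdCuspVec]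
  · rw [MatS1, vlast_hyp_mulVec]
    change _ = ((vlast (consSnoc q (consSnoc 0 (-w) 0) 1) : ℤ) : ℚ)
    simp [vfirst, stdCuspVec]

/-- The discriminant kernel preserves the index set of the Eisenstein series. -/
lemma mulVec_mem_cuspSet {c : Fin (n + 4) → ℚ} (hc : IsStdCusp n S c)
    {N P X : Matrix (Fin (n + 4)) (Fin (n + 4)) ℤ} (hX : N = 1 + X * MatS1 n S)
    (hNo : Nᵀ * MatS1 n S * N = MatS1 n S) (hP : MatS1 n S * N = Pᵀ * MatS1 n S)
    (hPN : P * N = 1) {g : Fin (n + 4) → ℚ} (hg : g ∈ cuspSet n S c) :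
    N.map (Int.cast : ℤ → ℚ) *ᵥ g ∈ cuspSet n S c := by
  obtain ⟨hgl, hgq, hgg⟩ := hg
  obtain ⟨Wc, hWc⟩ := exists_int_mulVec_MatS1 hc
  choose u hu using hgl
  have hgu : g = c + fun i => (u i : ℚ) := by
    funext i
    rw [Pi.add_apply, ← hu i]; ring
  obtain ⟨W, hW⟩ : ∃ W : Fin (n + 4) → ℤ,
      (MatS1 n S).map (Int.cast : ℤ → ℚ) *ᵥ g = fun i => (W i : ℚ) := by
    refine ⟨Wc + MatS1 n S *ᵥ u, ?_⟩
    rw [hgu, mulVec_add, hWc, map_mulVec_intCast]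
    funext i
    simp
  refine ⟨fun i => ⟨u i + (X *ᵥ W) i, ?_⟩, ?_, ?_⟩
  · have h : N.map (Int.cast : ℤ → ℚ) *ᵥ g = g + fun i => ((X *ᵥ W) i : ℚ) := by
      have h1 : N.map (Int.cast : ℤ → ℚ) = 1 + X.map Int.cast * (MatS1 n S).map Int.cast := by
        rw [← map_intCast_mul, ← map_intCast_one, hX]
        exact Matrix.map_add _ Int.cast_add _ _
      rw [h1, add_mulVec, one_mulVec, ← mulVec_mulVec, hW, map_mulVec_intCast]
    rw [h, Pi.add_apply, Int.cast_add, ← hu i]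
    ring
  · have hNo' : (N.map (Int.cast : ℤ → ℚ))ᵀ * (MatS1 n S).map Int.cast * N.map Int.cast =
        (MatS1 n S).map Int.cast := by
      rw [← transpose_map, ← map_intCast_mul, ← map_intCast_mul, hNo]
    rw [quadF, bilin_mulVec_mulVec hNo']
    exact hgq
  · have h : (MatS1 n S).map (Int.cast : ℤ → ℚ) *ᵥ (N.map (Int.cast : ℤ → ℚ) *ᵥ g) =
        fun i => ((Pᵀ *ᵥ W) i : ℚ) := by
      rw [mulVec_mulVec, ← map_intCast_mul, hP, map_intCast_mul, ← mulVec_mulVec, hW,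
        map_mulVec_intCast]
    rw [h]
    rw [hW] at hgg
    rw [← Nat.dvd_one, ← hgg, dvd_ratGcd_intCast]
    have hd := (dvd_ratGcd_intCast (Pᵀ *ᵥ W)).mp dvd_rfl
    intro i
    have hWi : W = Nᵀ *ᵥ (Pᵀ *ᵥ W) := by
      rw [mulVec_mulVec, ← transpose_mul, hPN, transpose_one, one_mulVec]
    rw [congrFun hWi i]
    change _ ∣ ∑ j, Nᵀ i j * (Pᵀ *ᵥ W) j
    exact Finset.dvd_sum fun j _ => Dvd.dvd.mul_left (hd j) _

lemma eq_zero_of_MatS1_mul_eq_zero (hpos : ∀ v : Fin n → ℝ, v ≠ 0 → 0 < bilin ℝ S v v)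
    {D : Matrix (Fin (n + 4)) (Fin (n + 4)) ℤ} (hD : MatS1 n S * D = 0) : D = 0 := by
  have hneg : ∀ v : Fin n → ℝ, ((-S).map (Int.cast : ℤ → ℝ)) *ᵥ v = 0 → v = 0 := by
    intro v hv
    by_contra hne
    have h := hpos v hne
    have h2 : bilin ℝ (-S) v v = 0 := by rw [bilin, hv, dotProduct_zero]
    rw [bilin_neg] at h2
    linarith
  ext i j
  have h := hyp_mulVec_eq_zero (hyp_mulVec_eq_zero hneg) (fun i => (D i j : ℝ)) (by
    change (MatS1 n S).map (Int.cast : ℤ → ℝ) *ᵥ (fun i => (D i j : ℝ)) = 0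
    rw [map_mulVec_intCast]
    funext l
    have : (MatS1 n S *ᵥ fun i => D i j) l = (MatS1 n S * D) l j := rfl
    rw [this, hD]
    simp)
  have h' : (D i j : ℝ) = 0 := congrFun h i
  exact_mod_cast h'

end Cusp

section Modularity

variable {n : ℕ} {S : Matrix (Fin n) (Fin n) ℤ}

lemma tsum_jay_actM (hS : S.IsSymm) (hpos : ∀ v : Fin n → ℝ, v ≠ 0 → 0 < bilin ℝ S v v)
    {c : Fin (n + 4) → ℚ} (hc : IsStdCusp n S c) (k : ℕ)
    {M : Matrix (Fin (n + 4)) (Fin (n + 4)) ℝ} (hM : M ∈ GammaTilde n S)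
    {z : Fin (n + 2) → ℂ} (hz : z ∈ HS n S) :
    ∑' g : cuspSet n S c, (jay n S g.1 (actM n S M z)) ^ (-(k : ℤ)) =
      jayM n S M z ^ k * ∑' g : cuspSet n S c, (jay n S g.1 z) ^ (-(k : ℤ)) := by
  obtain ⟨⟨hMp, -⟩, X, hX⟩ := hM
  have hMO : M ∈ OSet (MatS1 n S) := connectedComponentIn_subset _ _ hMp
  have hS1 : (MatS1 n S)ᵀ = MatS1 n S := isSymm_MatS1 hS
  obtain ⟨N, hN⟩ : ∃ N, N = 1 + X * MatS1 n S := ⟨_, rfl⟩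
  obtain ⟨P, hP⟩ : ∃ P, P = 1 + Xᵀ * MatS1 n S := ⟨_, rfl⟩
  have hMN : M = N.map Int.cast := by
    rw [hX, hN, ← map_intCast_one]
    exact (Matrix.map_add _ Int.cast_add _ _).symm
  have hNo : Nᵀ * MatS1 n S * N = MatS1 n S := by
    have h : Mᵀ * (MatS1 n S).map (Int.cast : ℤ → ℝ) * M = (MatS1 n S).map Int.cast := hMO
    rw [hMN, ← transpose_map, ← map_intCast_mul, ← map_intCast_mul] at h
    exact Matrix.map_injective Int.cast_injective h
  have hSP : MatS1 n S * P = Nᵀ * MatS1 n S := by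
    rw [hP, hN, transpose_add, transpose_mul, transpose_one, hS1, Matrix.mul_add, Matrix.add_mul,
      Matrix.mul_one, Matrix.one_mul, Matrix.mul_assoc]
  have hSN : MatS1 n S * N = Pᵀ * MatS1 n S := by
    rw [hP, hN, transpose_add, transpose_mul, transpose_one, hS1, Matrix.mul_add, Matrix.add_mul,
      Matrix.mul_one, Matrix.one_mul, Matrix.mul_assoc, transpose_transpose]
  have hPN : P * N = 1 := by
    rw [← sub_eq_zero]
    apply eq_zero_of_MatS1_mul_eq_zero hpos
    rw [Matrix.mul_sub, ← Matrix.mul_assoc, hSP, hNo, Matrix.mul_one, sub_self]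
  have hNP : N * P = 1 := mul_eq_one_comm.mp hPN
  have hPo : Pᵀ * MatS1 n S * P = MatS1 n S := by
    rw [← hSN, Matrix.mul_assoc, hNP, Matrix.mul_one]
  have hcast : ∀ {A B : Matrix (Fin (n + 4)) (Fin (n + 4)) ℤ}, A * B = 1 →
      ∀ g : Fin (n + 4) → ℚ, A.map (Int.cast : ℤ → ℚ) *ᵥ (B.map (Int.cast : ℤ → ℚ) *ᵥ g) = g := by
    intro A B h g
    rw [mulVec_mulVec, ← map_intCast_mul, h, map_intCast_one, one_mulVec]
  let e : cuspSet n S c ≃ cuspSet n S c :=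
    { toFun := fun g => ⟨P.map (Int.cast : ℤ → ℚ) *ᵥ g.1,
        mulVec_mem_cuspSet hc hP hPo hSP hNP g.2⟩
      invFun := fun g => ⟨N.map (Int.cast : ℤ → ℚ) *ᵥ g.1,
        mulVec_mem_cuspSet hc hN hNo hSN hPN g.2⟩
      left_inv := fun g => Subtype.ext (hcast hNP g.1)
      right_inv := fun g => Subtype.ext (hcast hPN g.1) }
  have hj := jayM_ne_zero hS hpos hMO hz
  have hjay : ∀ g : cuspSet n S c,
      jayM n S M z * jay n S g.1 (actM n S M z) = jay n S (e g).1 z := by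
    intro g
    have hPg : (fun i => (((P.map (Int.cast : ℤ → ℚ) *ᵥ g.1) i : ℝ) : ℂ)) =
        P.map (Int.cast : ℤ → ℂ) *ᵥ (fun i => ((g.1 i : ℝ) : ℂ)) := by
      funext i
      simp [mulVec, dotProduct]
    have hMC : M.map Complex.ofReal = N.map (Int.cast : ℤ → ℂ) := by
      rw [hMN]; ext; simp
    change _ = jay n S (P.map (Int.cast : ℤ → ℚ) *ᵥ g.1) z
    rw [jay_eq_bilin, jay_eq_bilin, ← bilin_smul_right, ← mulVec_isoLift hMO hj, hPg, hMC, bilin,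
      mulVec_mulVec, ← map_intCast_mul, hSN, bilin, map_intCast_mul, ← mulVec_mulVec,
      dotProduct_mulVec, transpose_map, vecMul_transpose]
  rw [← tsum_mul_left, ← e.tsum_eq fun g => jayM n S M z ^ k * (jay n S g.1 z) ^ (-(k : ℤ))]
  refine tsum_congr fun g => ?_
  rw [← hjay g, mul_zpow, ← mul_assoc, _root_.zpow_neg (jayM n S M z), zpow_natCast,
    mul_inv_cancel₀ (pow_ne_zero k hj), one_mul]

end Modularity

section Summability

variable {n : ℕ} {S : Matrix (Fin n) (Fin n) ℤ}

lemma continuous_bilin_left {m : ℕ} (A : Matrix (Fin m) (Fin m) ℤ) (w : Fin m → ℂ) :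
    Continuous fun h : Fin m → ℝ => bilin ℂ A (fun i => (h i : ℂ)) w := by
  simp only [bilin, dotProduct]
  fun_prop

lemma continuous_bilin_self {m : ℕ} (A : Matrix (Fin m) (Fin m) ℤ) :
    Continuous fun h : Fin m → ℝ => bilin ℝ A h h := by
  simp only [bilin, dotProduct, mulVec]
  fun_prop

lemma exists_pos_mul_norm_le (hS : S.IsSymm)
    (hpos : ∀ v : Fin n → ℝ, v ≠ 0 → 0 < bilin ℝ S v v)
    {z : Fin (n + 2) → ℂ} (hz : z ∈ HS n S) :
    ∃ ε > 0, ∀ h : Fin (n + 4) → ℝ, bilin ℝ (MatS1 n S) h h = 0 →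
      ε * ‖h‖ ≤ ‖bilin ℂ (MatS1 n S) (fun i => (h i : ℂ)) (isoLift n S z)‖ := by
  let T : Set (Fin (n + 4) → ℝ) :=
    Metric.sphere 0 1 ∩ {h | bilin ℝ (MatS1 n S) h h = 0}
  have hT : IsCompact T :=
    (isCompact_sphere 0 1).inter_right (isClosed_eq (continuous_bilin_self _) continuous_const)
  have hcont := (continuous_bilin_left (MatS1 n S) (isoLift n S z)).norm
  obtain ⟨ε, hε, hle⟩ : ∃ ε > 0, ∀ h ∈ T,
      ε ≤ ‖bilin ℂ (MatS1 n S) (fun i => (h i : ℂ)) (isoLift n S z)‖ := by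
    rcases T.eq_empty_or_nonempty with hE | hne
    · exact ⟨1, one_pos, by simp [hE]⟩
    · obtain ⟨h, hhT, hmin⟩ := hT.exists_isMinOn hne hcont.continuousOn
      refine ⟨_, norm_pos_iff.mpr (bilin_isoLift_ne_zero hS hpos hz hhT.2 ?_), fun x hx => hmin hx⟩
      rintro rfl
      simpa using hhT.1
  refine ⟨ε, hε, fun h hh => ?_⟩
  rcases eq_or_ne h 0 with rfl | h0
  · simp
  have hn : 0 < ‖h‖ := norm_pos_iff.mpr h0
  have hmem : ‖h‖⁻¹ • h ∈ T := by
    refine ⟨by simp [norm_smul, hn.ne'], ?_⟩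
    change bilin ℝ _ _ _ = 0
    rw [bilin_smul_left, bilin_smul_right, hh, mul_zero, mul_zero]
  have hcast : (fun i => (((‖h‖⁻¹ • h) i : ℝ) : ℂ)) = ((‖h‖⁻¹ : ℝ) : ℂ) • fun i => (h i : ℂ) := by
    funext i
    simp
  have h1 := hle _ hmem
  rw [hcast, bilin_smul_left, norm_mul, Complex.norm_real, norm_inv, norm_norm,
    ← div_eq_inv_mul, le_div_iff₀ hn] at h1
  exact h1

lemma abs_bilin_self_le {m : ℕ} (A : Matrix (Fin m) (Fin m) ℤ) (u : Fin m → ℝ) :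
    |bilin ℝ A u u| ≤ (∑ i, ∑ j, |(A i j : ℝ)|) * ‖u‖ ^ 2 := by
  have hu : ∀ i, |u i| ≤ ‖u‖ := norm_le_pi_norm u
  simp only [bilin, dotProduct, mulVec, Finset.mul_sum, Finset.sum_mul, map_apply]
  refine (Finset.abs_sum_le_sum_abs _ _).trans (Finset.sum_le_sum fun i _ => ?_)
  refine (Finset.abs_sum_le_sum_abs _ _).trans (Finset.sum_le_sum fun j _ => ?_)
  rw [abs_mul, abs_mul]
  calc |u i| * (|(A i j : ℝ)| * |u j|) = |(A i j : ℝ)| * (|u i| * |u j|) := by ring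
    _ ≤ |(A i j : ℝ)| * (‖u‖ * ‖u‖) := by gcongr <;> exact hu _
    _ = _ := by ring

lemma ratGcd_zero {m : ℕ} : ratGcd (0 : Fin m → ℚ) = 0 := by
  simp [ratGcd, Finset.gcd_eq_zero_iff]

lemma norm_intCast_pi {m : ℕ} (v : Fin m → ℤ) : ‖fun i => (v i : ℝ)‖ = ‖v‖ := by
  simp only [Pi.norm_def]
  rfl

/-- Integral coordinates of the elements of the index set. -/
lemma exists_int_coords {fc : Fin n → ℚ} (hq : ∃ q : ℤ, quadF ℚ S fc = q)
    {g : Fin (n + 4) → ℚ} (hg : inLatShift (stdCuspVec n S fc) g) :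
    ∃ (a b c e : ℤ) (v : Fin n → ℤ), vfirst g = a ∧ vfirst (vmid g) = b ∧ vlast (vmid g) = c ∧
      vlast g = e ∧ vmid (vmid g) = fc + fun i => (v i : ℚ) := by
  obtain ⟨q, hq⟩ := hq
  choose u hu using hg
  have hu' : ∀ i, g i = stdCuspVec n S fc i + u i := fun i => by rw [← hu i]; ring
  refine ⟨1 + vfirst u, vfirst (vmid u), vlast (vmid u), q + vlast u, vmid (vmid u),
    ?_, ?_, ?_, ?_, ?_⟩
  · simp [vfirst, hu', stdCuspVec]
  · simp [vfirst, vmid, hu', stdCuspVec]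
  · simp [vlast, vmid, hu', stdCuspVec]
  · simp [vlast, hu', stdCuspVec, ← hq]
  · rw [← vmid_vmid_stdCuspVec (S := S) fc]
    funext i
    exact hu' _

lemma one_le_norm_of_mem_cuspSet (hpos : ∀ v : Fin n → ℝ, v ≠ 0 → 0 < bilin ℝ S v v)
    {fc : Fin n → ℚ} (hq : ∃ q : ℤ, quadF ℚ S fc = q) {g : Fin (n + 4) → ℚ}
    (hg : g ∈ cuspSet n S (stdCuspVec n S fc))
    (hiso : bilin ℝ (MatS1 n S) (fun i => (g i : ℝ)) (fun i => (g i : ℝ)) = 0) :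
    1 ≤ ‖fun i => (g i : ℝ)‖ := by
  obtain ⟨a, b, c, e, v, ha, hb, hc, he, -⟩ := exists_int_coords hq hg.1
  have key : ∀ (i : Fin (n + 4)) (t : ℤ), g i = t → ‖fun i => (g i : ℝ)‖ < 1 → t = 0 := by
    intro i t ht hlt
    have h1 : |((g i : ℚ) : ℝ)| ≤ _ := norm_le_pi_norm (fun i => (g i : ℝ)) i
    rw [ht, Rat.cast_intCast] at h1
    rw [← Int.abs_lt_one_iff]
    exact_mod_cast h1.trans_lt hlt
  by_contra! hlt
  have ha0 : vfirst g = 0 := by rw [ha, key _ a ha hlt, Int.cast_zero]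
  have hb0 : vfirst (vmid g) = 0 := by rw [hb, key _ b hb hlt, Int.cast_zero]
  have hc0 : vlast (vmid g) = 0 := by rw [hc, key _ c hc hlt, Int.cast_zero]
  have he0 : vlast g = 0 := by rw [he, key _ e he hlt, Int.cast_zero]
  have hm0 : vmid (vmid g) = 0 := by
    have hA : vfirst (fun i => (g i : ℝ)) = 0 := by
      change ((vfirst g : ℚ) : ℝ) = 0
      rw [ha0, Rat.cast_zero]
    have hB : vfirst (vmid fun i => (g i : ℝ)) = 0 := by
      change ((vfirst (vmid g) : ℚ) : ℝ) = 0
      rw [hb0, Rat.cast_zero]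
    rw [bilin_MatS1, bilin_MatS0, hA, hB] at hiso
    have hz : vmid (vmid fun i => (g i : ℝ)) = 0 := by
      by_contra hne
      linarith [hpos _ hne]
    funext i
    have h : ((vmid (vmid g) i : ℚ) : ℝ) = 0 := congrFun hz i
    exact_mod_cast h
  have hg0 : g = 0 := vec_ext ha0 (vec_ext hb0 hm0 hc0) he0
  have h := hg.2.2
  rw [hg0, mulVec_zero, ratGcd_zero] at h
  exact zero_ne_one h

lemma summable_jay (hS : S.IsSymm) (hpos : ∀ v : Fin n → ℝ, v ≠ 0 → 0 < bilin ℝ S v v)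
    {c : Fin (n + 4) → ℚ} (hc : IsStdCusp n S c) {k : ℕ} (hk : n + 2 < k)
    {z : Fin (n + 2) → ℂ} (hz : z ∈ HS n S) :
    Summable fun g : cuspSet n S c => ‖(jay n S g.1 z) ^ (-(k : ℤ))‖ := by
  obtain ⟨fc, -, hq, rfl⟩ := hc
  have hiso : ∀ g : cuspSet n S (stdCuspVec n S fc),
      bilin ℝ (MatS1 n S) (fun i => (g.1 i : ℝ)) (fun i => (g.1 i : ℝ)) = 0 := by
    intro g
    have h : bilin ℚ (MatS1 n S) g.1 g.1 = 0 := by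
      have := g.2.2.1
      rw [quadF] at this
      linarith
    have h2 := bilin_map (Rat.castHom ℝ) (MatS1 n S) g.1 g.1
    rw [h, map_zero] at h2
    exact h2
  obtain ⟨ε, hε, hle⟩ := exists_pos_mul_norm_le hS hpos hz
  choose a b c' e v ha hb hc he hv using
    fun g : cuspSet n S (stdCuspVec n S fc) => exists_int_coords hq g.2.1
  let G : cuspSet n S (stdCuspVec n S fc) → ℝ := fun g => ‖fun i => (g.1 i : ℝ)‖
  let F : Fin n → ℝ := fun i => (fc i : ℝ)
  have hG : ∀ g, 1 ≤ G g := fun g => one_le_norm_of_mem_cuspSet hpos hq g.2 (hiso g)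
  have hR : ∀ g, vfirst (fun i => (g.1 i : ℝ)) = a g ∧ vfirst (vmid fun i => (g.1 i : ℝ)) = b g ∧
      vlast (vmid fun i => (g.1 i : ℝ)) = c' g ∧ vlast (fun i => (g.1 i : ℝ)) = e g ∧
      vmid (vmid fun i => (g.1 i : ℝ)) = F + fun i => (v g i : ℝ) := by
    intro g
    refine ⟨?_, ?_, ?_, ?_, ?_⟩
    · exact (congrArg (Rat.cast : ℚ → ℝ) (ha g)).trans (Rat.cast_intCast _)
    · exact (congrArg (Rat.cast : ℚ → ℝ) (hb g)).trans (Rat.cast_intCast _)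
    · exact (congrArg (Rat.cast : ℚ → ℝ) (hc g)).trans (Rat.cast_intCast _)
    · exact (congrArg (Rat.cast : ℚ → ℝ) (he g)).trans (Rat.cast_intCast _)
    · funext i
      have h := congrArg (Rat.cast : ℚ → ℝ) (congrFun (hv g) i)
      rw [Pi.add_apply, Rat.cast_add, Rat.cast_intCast] at h
      exact h
  have hent : ∀ (g : cuspSet n S (stdCuspVec n S fc)) (i : Fin (n + 4)) (t : ℤ), g.1 i = t →
      1 + |(t : ℝ)| ≤ G g * (2 + ‖F‖) := by
    intro g i t ht
    have h1 : |((g.1 i : ℚ) : ℝ)| ≤ G g := norm_le_pi_norm (fun i => (g.1 i : ℝ)) i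
    rw [ht, Rat.cast_intCast] at h1
    nlinarith [hG g, norm_nonneg F]
  have hsum : Summable fun g => ((G g * (2 + ‖F‖)) ^ k)⁻¹ := by
    refine summable_of_hyperbolic_eq hk
      (q := fun v => bilin ℝ S (F + fun i => (v i : ℝ)) (F + fun i => (v i : ℝ)) / 2)
      (C := (∑ i, ∑ j, |(S i j : ℝ)|) * (1 + ‖F‖) ^ 2) (by positivity) ?_ ?_
      a b c' e v ?_ ?_ _
      (fun g => hent g _ _ (ha g)) (fun g => hent g _ _ (he g))
      (fun g => hent g _ _ (hb g)) (fun g => hent g _ _ (hc g)) ?_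
    · intro v
      have h1 := abs_bilin_self_le S (F + fun i => (v i : ℝ))
      have h2 : ‖F + fun i => (v i : ℝ)‖ ≤ (1 + ‖F‖) * (1 + ‖v‖) := by
        refine (norm_add_le _ _).trans ?_
        rw [norm_intCast_pi]
        nlinarith [norm_nonneg F, norm_nonneg v, mul_nonneg (norm_nonneg F) (norm_nonneg v)]
      have h3 : (∑ i, ∑ j, |(S i j : ℝ)|) * ‖F + fun i => (v i : ℝ)‖ ^ 2 ≤
          (∑ i, ∑ j, |(S i j : ℝ)|) * ((1 + ‖F‖) * (1 + ‖v‖)) ^ 2 := by gcongr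
      rw [abs_div, abs_two, mul_assoc, ← mul_pow]
      linarith [abs_nonneg (bilin ℝ S (F + fun i => (v i : ℝ)) (F + fun i => (v i : ℝ)))]
    · have hzero : ∀ v : Fin n → ℤ,
          bilin ℝ S (F + fun i => (v i : ℝ)) (F + fun i => (v i : ℝ)) / 2 = 0 →
          (F + fun i => (v i : ℝ)) = 0 := by
        intro v h0
        by_contra hne
        linarith [hpos _ hne]
      intro v w hv0 hw0
      have h := add_left_cancel ((hzero v hv0).trans (hzero w hw0).symm)
      funext i
      exact_mod_cast congrFun h i
    · intro x y h1 h2 h3 h4 h5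
      refine Subtype.ext (vec_ext ?_ (vec_ext ?_ ?_ ?_) ?_)
      · rw [ha, ha, h1]
      · rw [hb, hb, h2]
      · rw [hv, hv, h5]
      · rw [hc, hc, h3]
      · rw [he, he, h4]
    · intro g
      obtain ⟨hA, hB, hC, hE, hV⟩ := hR g
      have h := hiso g
      rw [bilin_MatS1, bilin_MatS0, hA, hB, hC, hE, hV] at h
      linarith
    · intro g
      have h1 : ‖vmid (vmid fun i => (g.1 i : ℝ))‖ ≤ G g :=
        (pi_norm_le_iff_of_nonneg (norm_nonneg _)).mpr fun i =>
          norm_le_pi_norm (fun i => (g.1 i : ℝ)) _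
      rw [(hR g).2.2.2.2] at h1
      have h2 := norm_sub_le (F + fun i => (v g i : ℝ)) F
      rw [add_sub_cancel_left, norm_intCast_pi] at h2
      nlinarith [hG g, norm_nonneg F]
  refine Summable.of_nonneg_of_le (fun _ => norm_nonneg _) (fun g => ?_)
    (hsum.mul_left (((2 + ‖F‖) / ε) ^ k))
  have hGp : 0 < G g := zero_lt_one.trans_le (hG g)
  have hF : 0 < 2 + ‖F‖ := by positivity
  rw [norm_zpow, _root_.zpow_neg, zpow_natCast, div_pow, mul_pow]
  have h1 : ε * G g ≤ ‖jay n S g.1 z‖ := by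
    rw [jay_eq_bilin]
    exact hle _ (hiso g)
  calc (‖jay n S g.1 z‖ ^ k)⁻¹ ≤ ((ε * G g) ^ k)⁻¹ := by gcongr
    _ = (2 + ‖F‖) ^ k / ε ^ k * (G g ^ k * (2 + ‖F‖) ^ k)⁻¹ := by
      rw [mul_pow]
      field_simp

end Summability

end OEis

/-- absolute summability of the Eisenstein series attached to a
standard-form cusp, and its modularity of weight `k` for the discriminant
kernel. -/
theorem eisenstein_summable_and_modular
    (n : ℕ) (hn : 1 ≤ n) (S : Matrix (Fin n) (Fin n) ℤ)
    (hsymm : S.IsSymm)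
    (hpos : ∀ v : Fin n → ℝ, v ≠ 0 → 0 < bilin ℝ S v v)
    (heven : ∀ v : Fin n → ℤ, 2 ∣ v ⬝ᵥ S.mulVec v)
    (k : ℕ) (hk : n + 2 < k)
    (c : Fin (n + 4) → ℚ) (hc : IsStdCusp n S c) :
    (∀ z ∈ HS n S,
      Summable fun g : cuspSet n S c => ‖(jay n S g.1 z) ^ (-(k : ℤ))‖) ∧
    (∀ M ∈ GammaTilde n S, ∀ z ∈ HS n S,
      actM n S M z ∈ HS n S ∧
      (1 / 2 : ℂ) * ∑' g : cuspSet n S c, (jay n S g.1 (actM n S M z)) ^ (-(k : ℤ))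
        = (jayM n S M z) ^ (k : ℕ) *
          ((1 / 2 : ℂ) * ∑' g : cuspSet n S c, (jay n S g.1 z) ^ (-(k : ℤ)))) := by
  refine ⟨fun z hz => summable_jay hsymm hpos hc hk hz, fun M hM z hz =>
    ⟨actM_mem_HS hsymm hpos hM.1.1 hz, ?_⟩⟩
  rw [tsum_jay_actM hsymm hpos hc k hM hz]
  ring
end

section
/- Assume that every v ∈ S⁻¹ℤⁿ with Q(v) ∈ ℤ lies in ℤⁿ (i.e. the lattice ℤⁿ with Gram matrix S is maximal). Let k > n+2 be even and z ∈ H_S. Then (1/(2ζ(k)))·Σ_{g ∈ L₁^# \ {0}, Q₁(g)=0} j(g,z)^{−k} = (1/2)·Σ_{g ∈ L₁, Q₁(g)=0, gcd(S₁g)=1} j(g,z)^{−k}; in other words, the Eisenstein series E*_{k,S} and E_{k,S} attached to the standard cusp coincide. -/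
open Matrix Complex

namespace OEis

section Hyperbolic

variable {m : ℕ} {K : Type} [Field K] (A : Matrix (Fin m) (Fin m) ℤ)

theorem hyp_mulVec_first (g : Fin (m + 2) → K) :
    ((hyp A).map (Int.cast : ℤ → K)).mulVec g ⟨0, by omega⟩ = vlast g := by
  simp only [mulVec, dotProduct, map_apply]
  rw [Finset.sum_eq_single (⟨m + 1, by omega⟩ : Fin (m + 2))]
  · simp [hyp, vlast]
  · intro b _ hb
    have : (b : ℕ) ≠ m + 1 := fun h => hb (Fin.ext h)
    simp [hyp, this]
  · simp

theorem hyp_mulVec_last (g : Fin (m + 2) → K) :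
    ((hyp A).map (Int.cast : ℤ → K)).mulVec g ⟨m + 1, by omega⟩ = vfirst g := by
  simp only [mulVec, dotProduct, map_apply]
  rw [Finset.sum_eq_single (⟨0, by omega⟩ : Fin (m + 2))]
  · simp [hyp, vfirst]
  · intro b _ hb
    have : (b : ℕ) ≠ 0 := fun h => hb (Fin.ext h)
    simp [hyp, this]
  · simp

theorem sum_univ_ends (f : Fin (m + 2) → K) :
    ∑ i, f i = f ⟨0, by omega⟩ + ∑ i : Fin m, f ⟨(i : ℕ) + 1, by omega⟩
      + f ⟨m + 1, by omega⟩ := by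
  rw [Fin.sum_univ_succ, Fin.sum_univ_castSucc, ← add_assoc]
  rfl

theorem hyp_mulVec_mid (g : Fin (m + 2) → K) (i : Fin m) :
    ((hyp A).map (Int.cast : ℤ → K)).mulVec g ⟨(i : ℕ) + 1, by omega⟩
      = (A.map (Int.cast : ℤ → K)).mulVec (vmid g) i := by
  have hi : (i : ℕ) ≠ m := i.isLt.ne
  simp only [mulVec, dotProduct, map_apply]
  rw [sum_univ_ends]
  have h (j : Fin m) : hyp A ⟨(i : ℕ) + 1, by omega⟩ ⟨(j : ℕ) + 1, by omega⟩ = A i j := by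
    have hj : (j : ℕ) ≠ m := j.isLt.ne
    simp [hyp, hi, hj]
  simp only [h]
  simp [hyp, hi, vmid]

theorem quadF_hyp [CharZero K] (g : Fin (m + 2) → K) :
    quadF K (hyp A) g = vfirst g * vlast g + quadF K A (vmid g) := by
  have h : bilin K (hyp A) g g
      = vfirst g * vlast g + bilin K A (vmid g) (vmid g) + vlast g * vfirst g := by
    unfold bilin
    rw [dotProduct, sum_univ_ends, hyp_mulVec_first, hyp_mulVec_last]
    simp only [hyp_mulVec_mid]
    rfl
  rw [quadF, quadF, h]
  ring

theorem exists_first_mid_last (i : Fin (m + 2)) :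
    i = ⟨0, by omega⟩ ∨ i = ⟨m + 1, by omega⟩ ∨
      ∃ j : Fin m, i = ⟨(j : ℕ) + 1, by omega⟩ := by
  rcases Nat.eq_zero_or_pos (i : ℕ) with h | h
  · exact .inl (Fin.ext h)
  · by_cases h' : (i : ℕ) = m + 1
    · exact .inr (.inl (Fin.ext h'))
    · exact .inr (.inr ⟨⟨(i : ℕ) - 1, by omega⟩, Fin.ext (by simp; omega)⟩)

theorem eq_zero_of_hyp_mulVec_eq_zero
    (hA : ∀ v : Fin m → K, (A.map (Int.cast : ℤ → K)).mulVec v = 0 → v = 0)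
    (g : Fin (m + 2) → K) (hg : ((hyp A).map (Int.cast : ℤ → K)).mulVec g = 0) : g = 0 := by
  funext i
  rcases exists_first_mid_last i with rfl | rfl | ⟨j, rfl⟩
  · exact (hyp_mulVec_last A g).symm.trans (congrFun hg _)
  · exact (hyp_mulVec_first A g).symm.trans (congrFun hg _)
  · refine congrFun (hA (vmid g) (funext fun j => ?_)) j
    exact (hyp_mulVec_mid A g j).symm.trans (congrFun hg _)

theorem inDual_hyp_iff (g : Fin (m + 2) → ℚ) :
    inDual (hyp A) g ↔
      (∃ a : ℤ, vfirst g = a) ∧ (∃ b : ℤ, vlast g = b) ∧ inDual A (vmid g) := by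
  constructor
  · intro h
    refine ⟨?_, ?_, fun i => ?_⟩
    · simpa only [hyp_mulVec_last] using h ⟨m + 1, by omega⟩
    · simpa only [hyp_mulVec_first] using h ⟨0, by omega⟩
    · simpa only [hyp_mulVec_mid] using h ⟨(i : ℕ) + 1, by omega⟩
  · rintro ⟨h0, h1, h⟩ i
    rcases exists_first_mid_last i with rfl | rfl | ⟨j, rfl⟩
    · rwa [hyp_mulVec_first]
    · rwa [hyp_mulVec_last]
    · rw [hyp_mulVec_mid]
      exact h j

theorem inLat_of_first_last_mid (g : Fin (m + 2) → ℚ) (h0 : ∃ a : ℤ, vfirst g = a)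
    (h1 : ∃ b : ℤ, vlast g = b) (h : inLat (vmid g)) : inLat g := by
  intro i
  rcases exists_first_mid_last i with rfl | rfl | ⟨j, rfl⟩
  exacts [h0, h1, h j]

theorem map_neg_intCast : (-A).map (Int.cast : ℤ → K) = -A.map (Int.cast : ℤ → K) := by
  ext; simp

theorem inDual_of_inDual_neg {v : Fin m → ℚ} (h : inDual (-A) v) : inDual A v := by
  intro i
  obtain ⟨z, hz⟩ := h i
  refine ⟨-z, ?_⟩
  rw [map_neg_intCast, neg_mulVec, Pi.neg_apply] at hz
  push_cast
  rw [← hz, neg_neg]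

theorem quadF_neg (v : Fin m → K) : quadF K (-A) v = -quadF K A v := by
  simp only [quadF, bilin, map_neg_intCast, neg_mulVec, dotProduct_neg, neg_div]

theorem quadF_smul (c : K) (v : Fin m → K) : quadF K A (c • v) = c ^ 2 * quadF K A v := by
  simp only [quadF, bilin, mulVec_smul, dotProduct_smul, smul_dotProduct, smul_eq_mul]
  ring

theorem inDual_of_inLat {v : Fin m → ℚ} (h : inLat v) : inDual A v := by
  choose w hw using h
  intro i
  refine ⟨∑ j, A i j * w j, ?_⟩
  simp [mulVec, dotProduct, hw]

end Hyperbolic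

section RatGcd

variable {m : ℕ}

theorem ratGcd_intCast (w : Fin m → ℤ) :
    ratGcd (fun i => (w i : ℚ)) = Finset.univ.gcd fun i => (w i).natAbs := rfl

theorem ratGcd_nsmul (c : ℕ) {v : Fin m → ℚ} (hv : inLat v) :
    ratGcd ((c : ℚ) • v) = c * ratGcd v := by
  choose w hw using hv
  obtain rfl : v = fun i => (w i : ℚ) := funext hw
  have : (c : ℚ) • (fun i => (w i : ℚ)) = fun i => (((c : ℤ) * w i : ℤ) : ℚ) := by
    funext i; simp
  rw [this, ratGcd_intCast, ratGcd_intCast]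
  simp only [Int.natAbs_mul, Int.natAbs_natCast]
  rw [Finset.gcd_mul_left, normalize_eq]

theorem exists_eq_ratGcd_smul {v : Fin m → ℚ} (hv : inLat v) (hv0 : v ≠ 0) :
    0 < ratGcd v ∧ inLat ((ratGcd v : ℚ)⁻¹ • v) := by
  choose w hw using hv
  obtain rfl : v = fun i => (w i : ℚ) := funext hw
  rw [ratGcd_intCast]
  set d := Finset.univ.gcd fun i => (w i).natAbs with hd
  have hpos : 0 < d := by
    refine Nat.pos_of_ne_zero fun h => hv0 (funext fun i => ?_)
    simpa using Finset.gcd_eq_zero_iff.1 (hd.symm.trans h) i (Finset.mem_univ i)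
  refine ⟨hpos, fun i => ?_⟩
  obtain ⟨c, hc⟩ : (d : ℤ) ∣ w i :=
    Int.natCast_dvd.2 (Finset.gcd_dvd (Finset.mem_univ i))
  have : (d : ℚ) ≠ 0 := by positivity
  refine ⟨c, ?_⟩
  simp only [Pi.smul_apply, smul_eq_mul, hc]
  push_cast
  field_simp

end RatGcd

section Maximal

variable {n : ℕ} {S : Matrix (Fin n) (Fin n) ℤ}

theorem jay_smul (c : ℚ) (g : Fin (n + 4) → ℚ) (z : Fin (n + 2) → ℂ) :
    jay n S (c • g) z = c * jay n S g z := by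
  have h : (fun i => ((vmid (m := n + 2) (c • g) i : ℚ) : ℂ))
      = (c : ℂ) • fun i => ((vmid (m := n + 2) g i : ℚ) : ℂ) := by
    funext i; simp [vmid]
  unfold jay
  rw [h]
  simp only [bilin, smul_dotProduct, smul_eq_mul, vlast, vfirst, Pi.smul_apply]
  push_cast
  ring

theorem inLat_of_inDual_of_isotropic
    (hmax : ∀ v : Fin n → ℚ, inDual S v → (∃ z : ℤ, quadF ℚ S v = (z : ℚ)) → inLat v)
    {g : Fin (n + 4) → ℚ} (hg : inDual (MatS1 n S) g) (hQ : quadF ℚ (MatS1 n S) g = 0) :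
    inLat g := by
  obtain ⟨⟨a, ha⟩, ⟨b, hb⟩, h⟩ := (inDual_hyp_iff (MatS0 n S) g).1 hg
  obtain ⟨⟨a', ha'⟩, ⟨b', hb'⟩, h'⟩ := (inDual_hyp_iff (-S) (vmid (m := n + 2) g)).1 h
  have hQ' := hQ
  rw [MatS1, quadF_hyp (MatS0 n S) g, MatS0, quadF_hyp (-S), quadF_neg, ha, hb, ha', hb'] at hQ'
  refine inLat_of_first_last_mid (m := n + 2) g ⟨a, ha⟩ ⟨b, hb⟩
    (inLat_of_first_last_mid _ ⟨a', ha'⟩ ⟨b', hb'⟩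
      (hmax _ (inDual_of_inDual_neg S h') ⟨a * b + a' * b', ?_⟩))
  push_cast
  linarith

theorem MatS1_mulVec_ne_zero (hpos : ∀ v : Fin n → ℝ, v ≠ 0 → 0 < bilin ℝ S v v)
    {g : Fin (n + 4) → ℚ} (hg : g ≠ 0) :
    ((MatS1 n S).map (Int.cast : ℤ → ℚ)).mulVec g ≠ 0 := by
  refine fun h => hg (eq_zero_of_hyp_mulVec_eq_zero _
    (eq_zero_of_hyp_mulVec_eq_zero _ fun v hv => ?_) g h)
  by_contra hv0
  have hb : bilin ℚ S v v = 0 := by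
    rw [map_neg_intCast, neg_mulVec, neg_eq_zero] at hv
    rw [bilin, hv, dotProduct_zero]
  have hcast : bilin ℝ S (fun i => (v i : ℝ)) (fun i => (v i : ℝ)) = (bilin ℚ S v v : ℚ) := by
    simp [bilin, mulVec, dotProduct]
  refine (hpos (fun i => (v i : ℝ)) fun h0 => hv0 (funext fun i => ?_)).ne' ?_
  · simpa using congrFun h0 i
  · rw [hcast, hb, Rat.cast_zero]

variable (n S) in
/-- Nonzero isotropic vectors of the dual lattice `S₁⁻¹ℤ^{n+4}`. -/
abbrev DualIsotropic : Type :=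
  {g : Fin (n + 4) → ℚ // inDual (MatS1 n S) g ∧ g ≠ 0 ∧ quadF ℚ (MatS1 n S) g = 0}

variable (n S) in
/-- Isotropic vectors `g` of `ℤ^{n+4}` with `gcd(S₁g) = 1`. -/
abbrev PrimitiveIsotropic : Type :=
  {g : Fin (n + 4) → ℚ // inLat g ∧ quadF ℚ (MatS1 n S) g = 0 ∧
    ratGcd (((MatS1 n S).map (Int.cast : ℤ → ℚ)).mulVec g) = 1}

theorem PrimitiveIsotropic.ne_zero (g : PrimitiveIsotropic n S) : g.1 ≠ 0 := by
  intro h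
  have := g.2.2.2
  rw [h, mulVec_zero] at this
  have h0 := ratGcd_nsmul 0 (v := (0 : Fin (n + 4) → ℚ)) fun _ => ⟨0, by simp⟩
  simp only [smul_zero, zero_mul] at h0
  omega

theorem ratGcd_mulVec_natCast_smul (c : ℕ) {g : Fin (n + 4) → ℚ} (hg : inDual (MatS1 n S) g) :
    ratGcd (((MatS1 n S).map (Int.cast : ℤ → ℚ)).mulVec ((c : ℚ) • g))
      = c * ratGcd (((MatS1 n S).map (Int.cast : ℤ → ℚ)).mulVec g) := by
  rw [mulVec_smul]
  exact ratGcd_nsmul c hg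

/-- Positive multiples of primitive isotropic vectors. -/
def smulPrimitive (p : ℕ+ × PrimitiveIsotropic n S) : DualIsotropic n S :=
  ⟨((p.1 : ℕ) : ℚ) • p.2.1, by
    refine ⟨inDual_of_inLat _ fun i => ?_, smul_ne_zero (by simp) p.2.ne_zero, ?_⟩
    · obtain ⟨w, hw⟩ := p.2.2.1 i
      exact ⟨(p.1 : ℕ) * w, by simp [hw]⟩
    · rw [quadF_smul, p.2.2.2.1, mul_zero]⟩

theorem smulPrimitive_injective : Function.Injective (smulPrimitive (n := n) (S := S)) := by
  rintro ⟨a, g⟩ ⟨b, h⟩ hab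
  have hv : ((a : ℕ) : ℚ) • g.1 = ((b : ℕ) : ℚ) • h.1 := congrArg Subtype.val hab
  have hgcd (c : ℕ) (f : PrimitiveIsotropic n S) :
      ratGcd (((MatS1 n S).map (Int.cast : ℤ → ℚ)).mulVec ((c : ℚ) • f.1)) = c := by
    rw [ratGcd_mulVec_natCast_smul c (inDual_of_inLat _ f.2.1), f.2.2.2, mul_one]
  have hab' : (a : ℕ) = b := (hgcd a g).symm.trans
    ((congrArg (fun v => ratGcd (((MatS1 n S).map (Int.cast : ℤ → ℚ)).mulVec v)) hv).trans
      (hgcd b h))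
  obtain rfl : a = b := PNat.coe_injective hab'
  have ha : ((a : ℕ) : ℚ) ≠ 0 := by simp
  have hgh : g.1 = h.1 := by rw [← inv_smul_smul₀ ha g.1, hv, inv_smul_smul₀ ha]
  exact Prod.ext rfl (Subtype.ext hgh)

theorem smulPrimitive_surjective (hpos : ∀ v : Fin n → ℝ, v ≠ 0 → 0 < bilin ℝ S v v)
    (hmax : ∀ v : Fin n → ℚ, inDual S v → (∃ z : ℤ, quadF ℚ S v = (z : ℚ)) → inLat v) :
    Function.Surjective (smulPrimitive (n := n) (S := S)) := by
  rintro ⟨g, hg, hg0, hQ⟩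
  obtain ⟨hd, hint⟩ := exists_eq_ratGcd_smul hg (MatS1_mulVec_ne_zero hpos hg0)
  set d := ratGcd (((MatS1 n S).map (Int.cast : ℤ → ℚ)).mulVec g) with hd_def
  have hd0 : (d : ℚ) ≠ 0 := by positivity
  have hdual : inDual (MatS1 n S) ((d : ℚ)⁻¹ • g) := by
    rw [← mulVec_smul] at hint
    exact hint
  have hiso : quadF ℚ (MatS1 n S) ((d : ℚ)⁻¹ • g) = 0 := by rw [quadF_smul, hQ, mul_zero]
  have hprim : ratGcd (((MatS1 n S).map (Int.cast : ℤ → ℚ)).mulVec ((d : ℚ)⁻¹ • g)) = 1 := by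
    have h := ratGcd_mulVec_natCast_smul d hdual
    rw [smul_inv_smul₀ hd0, ← hd_def] at h
    exact Nat.eq_of_mul_eq_mul_left hd (by omega)
  exact ⟨(⟨d, hd⟩, ⟨_, inLat_of_inDual_of_isotropic hmax hdual hiso, hiso, hprim⟩),
    Subtype.ext (smul_inv_smul₀ hd0 g)⟩

end Maximal

/-- A product series with one summable factor that does not vanish at some index; no summability
of the other factor is needed. -/
theorem tsum_prod_mul {α β : Type*} {f : α → ℂ} {g : β → ℂ} (hf : Summable f) {a : α}
    (ha : f a ≠ 0) : ∑' p : α × β, f p.1 * g p.2 = (∑' x, f x) * ∑' y, g y := by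
  by_cases hg : Summable g
  · exact (tsum_mul_tsum_of_summable_norm hf.norm hg.norm).symm
  · have h : ¬ Summable fun p : α × β => f p.1 * g p.2 := fun h => by
      have h' : Summable ((fun p : α × β => f p.1 * g p.2) ∘ Prod.mk a) :=
        h.comp_injective (Prod.mk_right_injective a)
      exact hg ((summable_mul_left_iff ha).1 h')
    rw [tsum_eq_zero_of_not_summable hg, tsum_eq_zero_of_not_summable h, mul_zero]

theorem hasSum_pnat_zpow_neg {k : ℕ} (hk : 1 < k) :
    HasSum (fun a : ℕ+ => ((a : ℕ) : ℂ) ^ (-(k : ℤ))) (riemannZeta k) := by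
  have hs : Summable fun a : ℕ => 1 / (a : ℂ) ^ k := by
    simpa using Complex.summable_one_div_nat_cpow (p := (k : ℂ)).2 (by simpa using hk)
  have h0 : (1 : ℂ) / ((0 : ℕ) : ℂ) ^ k = 0 := by simp [show k ≠ 0 by omega]
  have h := hs.hasSum
  rw [← zeta_nat_eq_tsum_of_gt_one hk] at h
  have h' := (PNat.coe_injective.hasSum_iff (f := fun a : ℕ => 1 / (a : ℂ) ^ k) ?_).2 h
  · simpa [Function.comp_def] using h'
  · intro x hx
    obtain rfl : x = 0 := by
      by_contra hx0
      exact hx ⟨⟨x, Nat.pos_of_ne_zero hx0⟩, rfl⟩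
    exact h0

end OEis

open OEis

/-- for a maximal lattice the two Eisenstein series
`E*_{k,S}` and `E_{k,S}` at the standard cusp coincide. -/
theorem eisenstein_star_eq_eisenstein_of_maximal
    (n : ℕ) (hn : 1 ≤ n) (S : Matrix (Fin n) (Fin n) ℤ)
    (hsymm : S.IsSymm)
    (hpos : ∀ v : Fin n → ℝ, v ≠ 0 → 0 < bilin ℝ S v v)
    (heven : ∀ v : Fin n → ℤ, 2 ∣ v ⬝ᵥ S.mulVec v)
    (hmax : ∀ v : Fin n → ℚ, inDual S v → (∃ z : ℤ, quadF ℚ S v = (z : ℚ)) →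
      ∀ i, ∃ z : ℤ, v i = (z : ℚ))
    (k : ℕ) (hk : n + 2 < k) (hke : Even k)
    (z : Fin (n + 2) → ℂ) (hz : z ∈ HS n S) :
    (1 / (2 * riemannZeta (k : ℂ))) *
      ∑' g : {g : Fin (n + 4) → ℚ //
        inDual (MatS1 n S) g ∧ g ≠ 0 ∧ quadF ℚ (MatS1 n S) g = 0},
        (jay n S g.1 z) ^ (-(k : ℤ))
    = (1 / 2 : ℂ) *
      ∑' g : {g : Fin (n + 4) → ℚ //
        inLat g ∧ quadF ℚ (MatS1 n S) g = 0 ∧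
          ratGcd (((MatS1 n S).map (Int.cast : ℤ → ℚ)).mulVec g) = 1},
        (jay n S g.1 z) ^ (-(k : ℤ)) := by
  have hζ : riemannZeta (k : ℂ) ≠ 0 :=
    riemannZeta_ne_zero_of_one_lt_re (by simpa using (by omega : 1 < k))
  have hsum := hasSum_pnat_zpow_neg (k := k) (by omega)
  have hfactor := tsum_prod_mul (g := fun g : PrimitiveIsotropic n S =>
    jay n S g.1 z ^ (-(k : ℤ))) hsum.summable (a := 1) (by simp)
  rw [hsum.tsum_eq] at hfactor
  have hbij : Function.Bijective (smulPrimitive (n := n) (S := S)) :=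
    ⟨smulPrimitive_injective, smulPrimitive_surjective hpos hmax⟩
  have hreindex := (Equiv.ofBijective _ hbij).tsum_eq
      fun g : DualIsotropic n S => jay n S g.1 z ^ (-(k : ℤ))
  have hterm (p : ℕ+ × PrimitiveIsotropic n S) :
      jay n S (smulPrimitive p).1 z ^ (-(k : ℤ))
        = ((p.1 : ℕ) : ℂ) ^ (-(k : ℤ)) * jay n S p.2.1 z ^ (-(k : ℤ)) := by
    rw [smulPrimitive, jay_smul, mul_zpow, Rat.cast_natCast]
  rw [← hreindex]
  simp only [Equiv.ofBijective_apply, hterm]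
  rw [hfactor]
  field_simp
end
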